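/- arXiv:math/0411124 — 4 statements merged into one kernel-verified Lean document; each statement's English description precedes it below -/
import Mathlib

section
/- Let A be a reduced affine algebra over ℝ of Krull dimension d and let X = Spec A. Let (a₁, …, a_n) be a unimodular row in A^n. Suppose a₁ > 0 on X(ℝ). Then there exist b₂, …, b_n ∈ A such that, setting b = a₁ + b₂a₂ + … + b_na_n, one has b > 0 on X(ℝ), and the closed subscheme Z(b) of X is smooth of dimension ≤ d − 1 at every point of X ∖ Sing X, i.e. for every prime ideal 𝔭 of A containing b such that A_𝔭 is a regular local ring, the local ring (A/bA)_𝔭 is regular of dimension ≤ d − 1. -/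
/-- A commutative ring is *regular local* if it is a Noetherian local ring whose maximal ideal
can be generated by (Krull dimension)-many elements. -/
def IsRegularLocal (R : Type*) [CommRing R] : Prop :=
  IsNoetherianRing R ∧ ∃ _h : IsLocalRing R, ∃ s : Finset R,
    Ideal.span (s : Set R) = IsLocalRing.maximalIdeal R ∧
      (s.card : WithBot ℕ∞) = ringKrullDim R

theorem bt_aux (d : WithBot ℕ∞) (n : ℕ) (h : (n : WithBot ℕ∞) + 1 ≤ d + 1) :
    (n : WithBot ℕ∞) ≤ d := by
  induction d with
  | bot =>
    simp at h
  | coe d =>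
    induction d with
    | top => exact le_top
    | coe d =>
      have : n + 1 ≤ d + 1 := by exact_mod_cast h
      have h2 : n ≤ d := by omega
      exact_mod_cast h2

theorem bt_regular {R S : Type*} [CommRing R] [CommRing S] [IsLocalRing R]
    (hR : IsRegularLocal R) (g : R →+* S) (hg : Function.Surjective g) (x : R)
    (hker : RingHom.ker g = Ideal.span {x}) (hx : x ∈ IsLocalRing.maximalIdeal R)
    (hx2 : x ∉ IsLocalRing.maximalIdeal R ^ 2) :
    IsRegularLocal S ∧ ∃ m : ℕ, ringKrullDim S = m ∧ ringKrullDim R = (m + 1 : ℕ) := by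
  classical
  obtain ⟨hN, _, s, hs, hcard⟩ := hR
  have hNS : IsNoetherianRing S := isNoetherianRing_of_surjective R S g hg
  have : Nontrivial S := by
    rw [← not_subsingleton_iff_nontrivial]
    intro hsub
    have h1 : (1 : R) ∈ Ideal.span {x} := by
      rw [← hker, RingHom.mem_ker]; exact Subsingleton.elim _ _
    exact (Ideal.ne_top_iff_one _).mp (IsLocalRing.maximalIdeal.isMaximal R).ne_top
      ((Ideal.span_singleton_le_iff_mem _).mpr hx h1)
  have hloc : IsLocalHom g := hg.isLocalHom
  have hL : IsLocalRing S := IsLocalRing.of_surjective' g hg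
  obtain ⟨c, hc, hsum⟩ := Submodule.mem_span_finset.mp (hs ▸ hx : x ∈ Ideal.span (s : Set R))
  obtain ⟨i, his, hci⟩ : ∃ i ∈ s, IsUnit (c i) := by
    by_contra! hcon
    apply hx2
    rw [← hsum, pow_two]
    refine Ideal.sum_mem _ fun i hi => Ideal.mul_mem_mul ?_ ?_
    · exact (IsLocalRing.mem_maximalIdeal _).mpr (hcon i hi)
    · rw [← hs]; exact Ideal.subset_span hi
  have hgx : g x = 0 := by
    rw [← RingHom.mem_ker, hker]; exact Ideal.mem_span_singleton_self x
  let T : Finset S := (s.erase i).image g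
  have hTspan : Ideal.span (T : Set S) = IsLocalRing.maximalIdeal S := by
    have h1 : (IsLocalRing.maximalIdeal R).map g = IsLocalRing.maximalIdeal S := by
      exact IsLocalRing.map_maximalIdeal_of_surjective g hg
    rw [← h1, ← hs, Ideal.map_span]
    apply le_antisymm
    · apply Ideal.span_mono
      simp only [T, Finset.coe_image]
      exact Set.image_mono (Finset.coe_subset.mpr (Finset.erase_subset _ _))
    · rw [Ideal.span_le]
      rintro _ ⟨j, hj, rfl⟩
      have hmem : ∀ j ∈ s.erase i, g j ∈ Ideal.span (T : Set S) := fun j hj =>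
        Ideal.subset_span (Finset.mem_coe.mpr (Finset.mem_image_of_mem _ hj))
      by_cases hji : j = i
      · subst hji
        have e : g (c j) * g j + ∑ k ∈ s.erase j, g (c k) * g k = 0 := by
          rw [← hgx, ← hsum, ← Finset.add_sum_erase s _ his]
          simp
        have h2 : g (c j) * g j ∈ Ideal.span (T : Set S) := by
          rw [eq_neg_of_add_eq_zero_left e]
          exact neg_mem (Ideal.sum_mem _ fun k hk => Ideal.mul_mem_left _ _ (hmem k hk))
        exact (Ideal.unit_mul_mem_iff_mem _ (hci.map g)).mp h2
      · exact hmem j (Finset.mem_erase.mpr ⟨hji, hj⟩)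
  have hTcard : T.card + 1 ≤ s.card := by
    have := Finset.card_image_le (s := s.erase i) (f := g)
    have h2 := Finset.card_erase_add_one his
    simp only [T]; omega
  have hdimS : ringKrullDim S ≤ T.card := by
    refine (ringKrullDim_le_spanFinrank_maximalIdeal S).trans ?_
    rw [← hTspan]
    have := Submodule.spanFinrank_span_le_ncard_of_finite (R := S) (T.finite_toSet)
    rw [Set.ncard_coe_finset] at this
    exact_mod_cast this
  have hdimR : ringKrullDim R ≤ ringKrullDim S + 1 := by
    have h1 := ringKrullDim_le_ringKrullDim_quotient_add_card ({x} : Finset R) 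
      (by rw [IsLocalRing.ringJacobson_eq_maximalIdeal]; simpa using hx)
    have e : R ⧸ Ideal.span (({x} : Finset R) : Set R) ≃+* S :=
      (Ideal.quotEquivOfEq (by simp [hker])).trans (RingHom.quotientKerEquivOfSurjective hg)
    rw [ringKrullDim_eq_of_ringEquiv e] at h1
    simpa using h1
  have h4 : (s.card : WithBot ℕ∞) ≤ T.card + 1 :=
    hcard.le.trans (hdimR.trans (by gcongr))
  have h5 : s.card = T.card + 1 := le_antisymm (by exact_mod_cast h4) hTcard
  have h6 : ringKrullDim S = T.card := by
    refine le_antisymm hdimS ?_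
    rw [← hcard, h5] at hdimR
    push_cast at hdimR
    exact bt_aux _ _ hdimR
  exact ⟨⟨hNS, hL, T, hTspan, h6.symm⟩, T.card, h6, by rw [← hcard, h5]⟩

section
open Polynomial TensorProduct
theorem bt_exists_derivation (k K : Type*) [Field k] [Field K] [CharZero k] [Algebra k K]
    [Algebra.EssFiniteType k K] (h : K) (hh : Transcendental k h) :
    ∃ D : Derivation k K K, D h = 1 := by
  have inj : Function.Injective (aeval (R := k) h) := transcendental_iff_injective.mp hh
  let : Algebra k[X] K := (aeval (R := k) h).toAlgebra
  have hmap : algebraMap k[X] K X = h := by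
    change aeval h X = h
    simp
  have : IsScalarTower k k[X] K := IsScalarTower.of_algebraMap_eq' (aeval (R := k) h).comp_algebraMap.symm
  have : FaithfulSMul k[X] K := (faithfulSMul_iff_algebraMap_injective _ _).mpr inj
  let := FractionRing.liftAlgebra k[X] K
  have := FractionRing.isScalarTower_liftAlgebra k[X] K
  have : IsScalarTower k (FractionRing k[X]) K := by
    refine IsScalarTower.of_algebraMap_eq fun x => ?_
    rw [IsScalarTower.algebraMap_apply k k[X] K, IsScalarTower.algebraMap_apply k[X] (FractionRing k[X]) K,
      ← IsScalarTower.algebraMap_apply k k[X] (FractionRing k[X])]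
  have : CharZero (FractionRing k[X]) := charZero_of_injective_algebraMap (R := k[X]) (IsFractionRing.injective _ _)
  have : Algebra.EssFiniteType (FractionRing k[X]) K := Algebra.EssFiniteType.of_comp k _ _
  have : Algebra.FormallySmooth (FractionRing k[X]) K := Algebra.FormallySmooth.of_perfectField
  have : Algebra.FormallySmooth k[X] (FractionRing k[X]) := .of_isLocalization (nonZeroDivisors _)
  have : Algebra.FormallySmooth k[X] K := .comp _ (FractionRing k[X]) _
  have hne : KaehlerDifferential.D k K h ≠ 0 := by
    intro h0
    have h1 : KaehlerDifferential.mapBaseChange k k[X] K (1 ⊗ₜ KaehlerDifferential.D k k[X] X) = 0 := by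
      rw [KaehlerDifferential.mapBaseChange_tmul, one_smul, KaehlerDifferential.map_D, hmap, h0]
    obtain ⟨x, hx⟩ := (Algebra.H1Cotangent.exact_δ_mapBaseChange k k[X] K _).mp h1
    have : Subsingleton (Algebra.H1Cotangent k[X] K) := Algebra.FormallySmooth.subsingleton_h1Cotangent
    rw [Subsingleton.elim x 0, map_zero] at hx
    have h2 := congrArg (LinearMap.lTensor K (KaehlerDifferential.polynomialEquiv k).toLinearMap) hx
    have h3 := congrArg (TensorProduct.rid k[X] K) h2
    simp at h3
  obtain ⟨l, hl⟩ : ∃ l : Module.Dual K (Ω[K⁄k]), l (KaehlerDifferential.D k K h) ≠ 0 := by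
    by_contra! hcon
    exact hne ((Module.forall_dual_apply_eq_zero_iff K _).mp hcon)
  refine ⟨(l (KaehlerDifferential.D k K h))⁻¹ • l.compDer (KaehlerDifferential.D k K), ?_⟩
  simp [hl]

theorem bt_prime_case (k B : Type*) [Field k] [CharZero k] [CommRing B] [Algebra k B]
    [Algebra.FiniteType k B] (h : B) (P : Ideal B) [P.IsPrime] :
    ∃ s ∉ P, {t : k | ∃ p : Ideal B, p.IsPrime ∧ P ≤ p ∧ s ∉ p ∧
      ∃ u ∉ p, u * (h - algebraMap k B t) ∈ p ^ 2}.Finite := by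
  let K := FractionRing (B ⧸ P)
  have : Algebra.EssFiniteType k K := Algebra.EssFiniteType.comp k (B ⧸ P) K
  have hker : ∀ x : B, algebraMap B K x = 0 ↔ x ∈ P := by
    intro x
    rw [IsScalarTower.algebraMap_apply B (B ⧸ P) K, 
      map_eq_zero_iff _ (IsFractionRing.injective (B ⧸ P) K), Ideal.Quotient.algebraMap_eq, Ideal.Quotient.eq_zero_iff_mem]
  by_cases hh : Transcendental k (algebraMap B K h)
  · obtain ⟨D, hD⟩ := bt_exists_derivation k K _ hh
    -- clear denominators
    classical
    obtain ⟨G, hG⟩ := Algebra.FiniteType.out (R := k) (A := B)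
    obtain ⟨⟨s', hs'⟩, hsG⟩ := IsLocalization.exist_integer_multiples_of_finset (nonZeroDivisors (B ⧸ P))
      (G.image (fun x => D (algebraMap B K x)))
    obtain ⟨s, rfl⟩ := Ideal.Quotient.mk_surjective s'
    have hsP : s ∉ P := by
      intro hs
      rw [← Ideal.Quotient.eq_zero_iff_mem] at hs
      exact nonZeroDivisors.ne_zero hs' hs
    have key : ∀ x : B, ∃ y : B, algebraMap B K s * D (algebraMap B K x) = algebraMap B K y := by
      intro x
      have hx : x ∈ Algebra.adjoin k (G : Set B) := by rw [hG]; trivial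
      induction hx using Algebra.adjoin_induction with
      | mem x hx =>
        obtain ⟨y, hy⟩ := hsG _ (Finset.mem_image_of_mem _ hx)
        obtain ⟨y, rfl⟩ := Ideal.Quotient.mk_surjective y
        refine ⟨y, ?_⟩
        rw [Algebra.smul_def] at hy
        exact hy.symm
      | algebraMap r =>
        refine ⟨0, ?_⟩
        rw [← IsScalarTower.algebraMap_apply k B K, D.map_algebraMap]; simp
      | add x y _ _ hx hy =>
        obtain ⟨x', hx⟩ := hx
        obtain ⟨y', hy⟩ := hy
        exact ⟨x' + y', by simp only [map_add, mul_add, hx, hy]⟩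
      | mul x y _ _ hx hy =>
        obtain ⟨x', hx⟩ := hx
        obtain ⟨y', hy⟩ := hy
        refine ⟨x * y' + y * x', ?_⟩
        simp only [map_mul, map_add, D.leibniz, smul_eq_mul, ← hx, ← hy]; ring
    refine ⟨s, hsP, ?_⟩
    convert Set.finite_empty
    rw [Set.eq_empty_iff_forall_notMem]
    rintro t ⟨p, hp, hPp, hsp, u, hu, hmem⟩
    have key2 : ∀ z ∈ p ^ 2, ∃ y ∈ p, algebraMap B K s * D (algebraMap B K z) = algebraMap B K y := by
      intro z hz
      rw [pow_two] at hz
      induction hz using Submodule.mul_induction_on' with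
      | mem_mul_mem x hx y hy =>
        obtain ⟨x', hx'⟩ := key x
        obtain ⟨y', hy'⟩ := key y
        refine ⟨x * y' + y * x', p.add_mem (p.mul_mem_right _ hx) (p.mul_mem_right _ hy), ?_⟩
        simp only [map_mul, map_add, D.leibniz, smul_eq_mul, ← hx', ← hy']; ring
      | add x _ y _ hx hy =>
        obtain ⟨x', hxp, hx⟩ := hx
        obtain ⟨y', hyp, hy⟩ := hy
        exact ⟨x' + y', p.add_mem hxp hyp, by simp only [map_add, mul_add, hx, hy]⟩
    obtain ⟨y, hy, e⟩ := key2 _ hmem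
    obtain ⟨u', hu'⟩ := key u
    have hht : h - algebraMap k B t ∈ p :=
      (hp.mem_or_mem (Ideal.pow_le_self two_ne_zero hmem)).resolve_left hu
    have e2 : algebraMap B K (u * s + (h - algebraMap k B t) * u' - y) = 0 := by
      rw [map_sub, ← e, map_mul (algebraMap B K) u, D.leibniz, map_sub (algebraMap B K) h, map_sub D, hD,
        ← IsScalarTower.algebraMap_apply k B K, D.map_algebraMap]
      simp only [map_add, map_mul, map_sub, ← hu', smul_eq_mul, ← IsScalarTower.algebraMap_apply k B K]
      ring
    have e3 := hPp ((hker _).mp e2)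
    have : u * s ∈ p := by
      have := p.sub_mem (p.add_mem e3 hy) (p.mul_mem_right u' hht)
      have e4 : u * s = u * s + (h - algebraMap k B t) * u' - y + y - (h - algebraMap k B t) * u' := by ring
      rw [e4]; exact this
    exact (hp.mem_or_mem this).elim hu hsp
  · refine ⟨1, (Ideal.ne_top_iff_one P).mp Ideal.IsPrime.ne_top', ?_⟩
    have hh : IsAlgebraic k (algebraMap B K h) := by simpa [Transcendental] using hh
    obtain ⟨f, hf0, hf⟩ := hh
    refine (f.rootSet_finite k).subset ?_
    rintro t ⟨p, hp, hPp, -, u, hu, hmem⟩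
    have hht : h - algebraMap k B t ∈ p :=
      (hp.mem_or_mem (Ideal.pow_le_self two_ne_zero hmem)).resolve_left hu
    rw [mem_rootSet]
    refine ⟨hf0, ?_⟩
    have h1 : aeval h f ∈ p := hPp ((hker _).mp (by rw [← aeval_algebraMap_apply, hf]))
    have h2 : aeval h f - aeval (algebraMap k B t) f ∈ p := by
      refine Ideal.mem_of_dvd _ ?_ hht
      rw [aeval_def, aeval_def, ← eval_map, ← eval_map]
      exact sub_dvd_eval_sub _ _ _
    have h3 : algebraMap k B (aeval t f) ∈ p := by
      rw [← aeval_algebraMap_apply]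
      simpa using p.sub_mem h1 h2
    by_contra hne
    exact hp.ne_top (Ideal.eq_top_of_isUnit_mem _ h3 ((IsUnit.mk0 _ hne).map _))

theorem bt_finite (k B : Type*) [Field k] [CharZero k] [CommRing B] [Algebra k B]
    [Algebra.FiniteType k B] (h : B) :
    {t : k | ∃ p : Ideal B, p.IsPrime ∧ 
      ∃ u ∉ p, u * (h - algebraMap k B t) ∈ p ^ 2}.Finite := by
  have : IsNoetherianRing B := Algebra.FiniteType.isNoetherianRing k B
  suffices H : ∀ I : Ideal B, {t : k | ∃ p : Ideal B, p.IsPrime ∧ I ≤ p ∧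
      ∃ u ∉ p, u * (h - algebraMap k B t) ∈ p ^ 2}.Finite by
    simpa using H ⊥
  intro I
  induction I using IsNoetherian.induction with
  | hgt I ih =>
    change Ideal B at I
    by_cases hI : I.IsPrime
    · obtain ⟨s, hs, hfin⟩ := bt_prime_case k B h I
      refine (hfin.union (ih (I ⊔ Ideal.span {s}) ?_)).subset ?_
      · exact Submodule.lt_sup_iff_notMem.mpr hs
      · rintro t ⟨p, hp, hIp, hu⟩
        by_cases hsp : s ∈ p
        · right
          exact ⟨p, hp, sup_le hIp ((Ideal.span_singleton_le_iff_mem _).mpr hsp), hu⟩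
        · left; exact ⟨p, hp, hIp, hsp, hu⟩
    · by_cases hT : I = ⊤
      · convert Set.finite_empty
        rw [Set.eq_empty_iff_forall_notMem]
        rintro t ⟨p, hp, hIp, hu⟩
        exact hp.ne_top (top_le_iff.mp (hT ▸ hIp))
      · rw [Ideal.isPrime_iff] at hI
        push Not at hI
        obtain ⟨x, y, hxy, hx, hy⟩ := hI hT
        refine ((ih (I ⊔ Ideal.span {x}) ?_).union (ih (I ⊔ Ideal.span {y}) ?_)).subset ?_
        · exact Submodule.lt_sup_iff_notMem.mpr hx
        · exact Submodule.lt_sup_iff_notMem.mpr hy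
        · rintro t ⟨p, hp, hIp, hu⟩
          rcases hp.mem_or_mem (hIp hxy) with hsp | hsp
          · left
            exact ⟨p, hp, sup_le hIp ((Ideal.span_singleton_le_iff_mem _).mpr hsp), hu⟩
          · right
            exact ⟨p, hp, sup_le hIp ((Ideal.span_singleton_le_iff_mem _).mpr hsp), hu⟩

theorem bt_finite_away (k A : Type*) [Field k] [CharZero k] [CommRing A] [Algebra k A]
    [Algebra.FiniteType k A] (f g : A) :
    {t : k | ∃ p : Ideal A, p.IsPrime ∧ g ∉ p ∧
      ∃ u ∉ p, u * (f + t • g) ∈ p ^ 2}.Finite := by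
  let B := Localization.Away g
  have : Algebra.FiniteType A B := IsLocalization.finiteType_of_monoid_fg (Submonoid.powers g) B
  have : Algebra.FiniteType k B := Algebra.FiniteType.trans (S := A) inferInstance inferInstance
  obtain ⟨v, hv⟩ := (IsLocalization.Away.algebraMap_isUnit (S := B) g).exists_right_inv
  refine (bt_finite k B (- (algebraMap A B f * v))).subset ?_
  rintro t ⟨p, hp, hg, u, hu, hmem⟩
  have hdisj : Disjoint (Submonoid.powers g : Set A) p :=
    (Ideal.disjoint_powers_iff_notMem g hp.isRadical).mpr hg
  have hprime := IsLocalization.isPrime_of_isPrime_disjoint (Submonoid.powers g) B p hp hdisj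
  have hcomap := IsLocalization.under_map_of_isPrime_disjoint (Submonoid.powers g) B hp hdisj
  refine ⟨p.map (algebraMap A B), hprime, algebraMap A B u, ?_, ?_⟩
  · intro hc
    apply hu
    rw [← hcomap]; exact hc
  · have h1 := Ideal.mem_map_of_mem (algebraMap A B) hmem
    rw [Ideal.map_pow] at h1
    have h2 := Ideal.mul_mem_right (-v) _ h1
    convert h2 using 1
    rw [map_mul, map_add, Algebra.smul_def, map_mul, ← IsScalarTower.algebraMap_apply k A B]
    linear_combination (algebraMap A B u) * (algebraMap k B t) * hv

end

theorem bt_choose (A : Type*) [CommRing A] [Algebra ℝ A] [Algebra.FiniteType ℝ A]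
    (n : ℕ) (a0 : A) (a : Fin n → A) (s : Finset (Fin n)) :
    ∃ c : Fin n → ℝ, (∀ i, 0 ≤ c i) ∧ ∀ p : Ideal A, p.IsPrime → (∃ i ∈ s, a i ∉ p) →
      ∀ u ∉ p, u * (a0 + ∑ i ∈ s, c i • (a i) ^ 2) ∉ p ^ 2 := by
  classical
  induction s using Finset.induction_on with
  | empty => exact ⟨0, by simp, by simp⟩
  | insert i s hi ih =>
    obtain ⟨c, hc, hP⟩ := ih
    obtain ⟨t, ht0, ht⟩ := (Set.Ici_infinite (0 : ℝ)).exists_notMem_finite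
      (bt_finite_away ℝ A (a0 + ∑ i ∈ s, c i • (a i) ^ 2) ((a i) ^ 2))
    refine ⟨Function.update c i t, ?_, ?_⟩
    · intro j
      by_cases hj : j = i
      · subst hj; simpa using ht0
      · simpa [Function.update_of_ne hj] using hc j
    · intro p hp hex u hu hmem
      have hsum : a0 + ∑ j ∈ insert i s, Function.update c i t j • (a j) ^ 2 =
          (a0 + ∑ j ∈ s, c j • (a j) ^ 2) + t • (a i) ^ 2 := by
        rw [Finset.sum_insert hi, Function.update_self]
        have : ∑ j ∈ s, Function.update c i t j • (a j) ^ 2 = ∑ j ∈ s, c j • (a j) ^ 2 := by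
          refine Finset.sum_congr rfl fun j hj => ?_
          rw [Function.update_of_ne (ne_of_mem_of_not_mem hj hi)]
        rw [this]; ring
      rw [hsum] at hmem
      by_cases hai : a i ∈ p
      · have hex' : ∃ j ∈ s, a j ∉ p := by
          obtain ⟨j, hj, hjp⟩ := hex
          rcases Finset.mem_insert.mp hj with rfl | hj
          · exact absurd hai hjp
          · exact ⟨j, hj, hjp⟩
        apply hP p hp hex' u hu
        rw [mul_add] at hmem
        refine (Ideal.add_mem_iff_left _ ?_).mp hmem
        rw [Algebra.smul_def]
        exact Ideal.mul_mem_left _ _ (Ideal.mul_mem_left _ _ (Ideal.pow_mem_pow hai 2))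
      · exact ht ⟨p, hp, fun h => hai (hp.mem_of_pow_mem 2 h), u, hu, hmem⟩

theorem bt_local (A : Type*) [CommRing A] (b : A) (q : Ideal (A ⧸ Ideal.span {b})) [q.IsPrime]
    (hb : ∀ u ∉ q.comap (Ideal.Quotient.mk (Ideal.span {b})),
      u * b ∉ (q.comap (Ideal.Quotient.mk (Ideal.span {b}))) ^ 2)
    (hR : IsRegularLocal (Localization.AtPrime (q.comap (Ideal.Quotient.mk (Ideal.span {b}))))) :
    IsRegularLocal (Localization.AtPrime q) ∧ ∃ m : ℕ, ringKrullDim (Localization.AtPrime q) = m ∧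
      ringKrullDim (Localization.AtPrime (q.comap (Ideal.Quotient.mk (Ideal.span {b})))) =
        (m + 1 : ℕ) := by
  set p := q.comap (Ideal.Quotient.mk (Ideal.span {b})) with hpdef
  let R := Localization.AtPrime p
  have hM : Algebra.algebraMapSubmonoid (A ⧸ Ideal.span {b}) p.primeCompl = q.primeCompl := by
    ext y
    constructor
    · rintro ⟨x, hx, rfl⟩
      exact hx
    · intro hy
      obtain ⟨x, rfl⟩ := Ideal.Quotient.mk_surjective y
      exact ⟨x, hy, rfl⟩
  let Q := R ⧸ (Ideal.span {b}).map (algebraMap A R)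
  have hloc : IsLocalization (Algebra.algebraMapSubmonoid (A ⧸ Ideal.span {b}) p.primeCompl) Q :=
    inferInstance
  rw [hM] at hloc
  let e : Q ≃+* Localization.AtPrime q :=
    (IsLocalization.algEquiv q.primeCompl Q (Localization.AtPrime q)).toRingEquiv
  have hbp : b ∈ p := by
    rw [hpdef, Ideal.mem_comap, Ideal.Quotient.eq_zero_iff_mem.mpr (Ideal.mem_span_singleton_self b)]
    exact zero_mem _
  have hmax : p.map (algebraMap A R) = IsLocalRing.maximalIdeal R :=
    Localization.AtPrime.map_eq_maximalIdeal
  refine bt_regular hR ((e : Q →+* _).comp (Ideal.Quotient.mk _)) ?_ (algebraMap A R b) ?_ ?_ ?_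
  · exact e.surjective.comp Ideal.Quotient.mk_surjective
  · ext y
    rw [RingHom.mem_ker, RingHom.comp_apply, RingHom.coe_coe, map_eq_zero_iff e e.injective,
      Ideal.Quotient.eq_zero_iff_mem, Ideal.map_span, Set.image_singleton]
  · rw [← hmax]; exact Ideal.mem_map_of_mem _ hbp
  · rw [← hmax, ← Ideal.map_pow, IsLocalization.algebraMap_mem_map_algebraMap_iff p.primeCompl]
    rintro ⟨u, hu, h⟩
    exact hb u hu h

/-- **Ojanguren–Parimala.** Let `A` be a reduced affine `ℝ`-algebra of dimension `d` and let
`(a₁, …, a_n)` be a unimodular row with `a₁ > 0` on `X(ℝ)` (the real points of `X = Spec A`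
being identified with the `ℝ`-algebra homomorphisms `A → ℝ`).  Then there are `b₂, …, b_n ∈ A`
such that `b = a₁ + b₂a₂ + ⋯ + b_na_n > 0` on `X(ℝ)` and `Z(b)` is smooth of dimension
`≤ d - 1` on `X ∖ Sing X`: for every prime `𝔭 ⊇ (b)` with `A_𝔭` regular, `(A/bA)_𝔭` is a
regular local ring of dimension `≤ d - 1`. -/
theorem unimodular_row_positive_smooth_section
    (A : Type*) [CommRing A] [Algebra ℝ A] [Algebra.FiniteType ℝ A] [IsReduced A]
    (d : ℕ) (hdim : ringKrullDim A = d)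
    (n : ℕ) (a : Fin (n + 1) → A) (hum : Ideal.span (Set.range a) = ⊤)
    (hpos : ∀ φ : A →ₐ[ℝ] ℝ, 0 < φ (a 0)) :
    ∃ (w : Fin n → A) (b : A), b = a 0 + ∑ i : Fin n, w i * a i.succ ∧
      (∀ φ : A →ₐ[ℝ] ℝ, 0 < φ b) ∧
      ∀ 𝔮 : PrimeSpectrum (A ⧸ Ideal.span {b}),
        IsRegularLocal
          (Localization.AtPrime (𝔮.asIdeal.comap (Ideal.Quotient.mk (Ideal.span {b})))) →
        IsRegularLocal (Localization.AtPrime 𝔮.asIdeal) ∧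
          ringKrullDim (Localization.AtPrime 𝔮.asIdeal) ≤ ((d - 1 : ℕ) : WithBot ℕ∞) := by
  obtain ⟨c, hc, hP⟩ := bt_choose A n (a 0) (fun i => a i.succ) Finset.univ
  refine ⟨fun i => c i • a i.succ, a 0 + ∑ i, c i • (a i.succ) ^ 2, ?_, ?_, ?_⟩
  · congr 1
    refine Finset.sum_congr rfl fun i _ => ?_
    rw [smul_mul_assoc, pow_two]
  · intro φ
    rw [map_add, map_sum]
    refine add_pos_of_pos_of_nonneg (hpos φ) (Finset.sum_nonneg fun i _ => ?_)
    rw [map_smul, map_pow, smul_eq_mul]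
    exact mul_nonneg (hc i) (sq_nonneg _)
  · generalize hbdef : a 0 + ∑ i, c i • (a i.succ) ^ 2 = b at hP ⊢
    intro 𝔮 hreg
    have hbp : b ∈ 𝔮.asIdeal.comap (Ideal.Quotient.mk (Ideal.span {b})) := by
      rw [Ideal.mem_comap,
        Ideal.Quotient.eq_zero_iff_mem.mpr (Ideal.mem_span_singleton_self b)]
      exact zero_mem _
    have hp : (𝔮.asIdeal.comap (Ideal.Quotient.mk (Ideal.span {b}))).IsPrime := inferInstance
    obtain ⟨h1, m, hm, hm'⟩ := bt_local A b 𝔮.asIdeal (by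
      refine hP _ hp ?_
      by_contra! hcon
      apply hp.ne_top
      rw [← top_le_iff, ← hum, Ideal.span_le]
      have h0 : ∑ i, c i • (a i.succ) ^ 2 ∈
          𝔮.asIdeal.comap (Ideal.Quotient.mk (Ideal.span {b})) := by
        refine Ideal.sum_mem _ fun i _ => ?_
        rw [Algebra.smul_def]
        exact Ideal.mul_mem_left _ _
          (Ideal.pow_mem_of_mem _ (hcon i (Finset.mem_univ i)) 2 two_pos)
      rintro _ ⟨i, rfl⟩
      refine Fin.cases ?_ (fun i => ?_) i
      · exact (Ideal.add_mem_iff_left _ h0).mp (by rw [hbdef]; exact hbp)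
      · exact hcon i (Finset.mem_univ i)) hreg
    refine ⟨h1, ?_⟩
    have h2 : ringKrullDim (Localization.AtPrime
        (𝔮.asIdeal.comap (Ideal.Quotient.mk (Ideal.span {b})))) ≤ ringKrullDim A := by
      rw [IsLocalization.AtPrime.ringKrullDim_eq_height
        (𝔮.asIdeal.comap (Ideal.Quotient.mk (Ideal.span {b})))]
      exact Ideal.height_le_ringKrullDim_of_ne_top hp.ne_top
    rw [hm', hdim] at h2
    have h3 : m + 1 ≤ d := by exact_mod_cast h2
    rw [hm]
    have h4 : m ≤ d - 1 := by omega
    exact_mod_cast h4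
end

section
/- Let B be a commutative Noetherian ring of Krull dimension n and let Q be a finitely generated projective B-module of constant rank n. Let J be an ideal of B of height ≥ 1. Suppose (a, q) ∈ Um(B ⊕ Q). Then there exists an automorphism Ψ of B ⊕ Q such that (a, q)Ψ = (a₁, q̃) with a₁ ≡ 1 (mod J) and O(q̃) + J = B. -/
/-- An element `m` of an `R`-module `M` is *unimodular* if some linear functional maps it to `1`. -/
def IsUnimodular (R : Type*) {M : Type*} [CommRing R] [AddCommGroup M] [Module R M]
    (m : M) : Prop :=
  ∃ ψ : M →ₗ[R] R, ψ m = 1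

/-- The (finite) rank of the `R`-module `M` at a prime `𝔭` of `R`. -/
noncomputable def rankAt (R M : Type*) [CommRing R] [AddCommGroup M] [Module R M]
    (𝔭 : PrimeSpectrum R) : ℕ :=
  Module.finrank (Localization.AtPrime 𝔭.asIdeal) (LocalizedModule 𝔭.asIdeal.primeCompl M)

/-- `O(q)`: the ideal of `B` generated by `ψ(q)`, `ψ ∈ Q*`. -/
def orderIdeal (B : Type*) {Q : Type*} [CommRing B] [AddCommGroup Q] [Module B Q]
    (q : Q) : Ideal B :=
  Ideal.span {x : B | ∃ ψ : Q →ₗ[B] B, ψ q = x}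

theorem ugp_avoid {B : Type*} [CommRing B] (T : Finset (Ideal B)) (hp : ∀ p ∈ T, p.IsPrime)
    (hinc : ∀ p ∈ T, ∀ q ∈ T, p ≤ q → p = q) (b x : B) (hx : ∀ p ∈ T, x ∉ p) :
    ∃ c : B, ∀ p ∈ T, b + x * c ∉ p := by
  classical
  have key : ∃ c ∈ (T.filter (fun p => b ∉ p)).inf id, ∀ p ∈ T.filter (fun p => b ∈ p), c ∉ p := by
    by_contra! h
    have h1 : (((T.filter (fun p => b ∉ p)).inf id : Ideal B) : Set B) ⊆
        ⋃ i ∈ (↑(T.filter (fun p => b ∈ p)) : Set (Ideal B)), ((id i : Ideal B) : Set B) := by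
      intro c hc
      obtain ⟨p, hp1, hp2⟩ := h c hc
      exact Set.mem_biUnion (by exact_mod_cast hp1) hp2
    obtain ⟨p, hpm, hle⟩ := (Ideal.subset_union_prime (f := id) ⊥ ⊥
      (fun i hi _ _ => hp i (Finset.mem_filter.1 hi).1)).1 h1
    rw [Finset.mem_filter] at hpm
    obtain ⟨q, hq, hqp⟩ := ((hp p hpm.1).inf_le').1 hle
    rw [Finset.mem_filter] at hq
    have := hinc q hq.1 p hpm.1 hqp
    subst this
    exact hq.2 hpm.2
  obtain ⟨c, hc, hc2⟩ := key
  refine ⟨c, fun p hpT hmem => ?_⟩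
  by_cases hb : b ∈ p
  · have h2 := (Ideal.add_mem_iff_right p hb).1 hmem
    rcases (hp p hpT).mem_or_mem h2 with h | h
    · exact hx p hpT h
    · exact hc2 p (Finset.mem_filter.2 ⟨hpT, hb⟩) h
  · have : c ∈ p := (Finset.inf_le (f := id) (Finset.mem_filter.2 ⟨hpT, hb⟩) : _ ≤ p) hc
    exact hb ((Ideal.add_mem_iff_left p (p.mul_mem_left x this)).1 hmem)

theorem ugp_stable {B : Type*} [CommRing B] [IsNoetherianRing B] (I : Ideal B)
    (hI : ∀ p ∈ minimalPrimes B, ¬ I ≤ p) (b : ℕ → B) (x : B) (r : ℕ) :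
    ∃ c : ℕ → B, ∀ p : Ideal B, p.IsPrime → I ≤ p → x ∉ p →
      (∀ i < r, b i + x * c i ∈ p) → ((r + 1 : ℕ) : ℕ∞) ≤ p.height := by
  classical
  induction r with
  | zero =>
    refine ⟨0, fun p hp hIp _ _ => ?_⟩
    have : p.height ≠ 0 := fun h => hI p (Ideal.height_eq_zero_iff.1 h) hIp
    simpa using Order.one_le_iff_pos.2 (pos_iff_ne_zero.2 this)
  | succ r ih =>
    obtain ⟨c, hc⟩ := ih
    set K : Ideal B := I ⊔ Ideal.span {y | ∃ i < r, y = b i + x * c i} with hK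
    have hfin := K.finite_minimalPrimes_of_isNoetherianRing B
    set T := hfin.toFinset.filter (fun p => x ∉ p) with hT
    have hTmem : ∀ p, p ∈ T ↔ p ∈ K.minimalPrimes ∧ x ∉ p := by
      intro p; simp [hT]
    obtain ⟨d, hd⟩ := ugp_avoid T (fun p h => ((hTmem p).1 h).1.1.1)
      (fun p h q h' hle => le_antisymm hle
        (((hTmem q).1 h').1.2 ((hTmem p).1 h).1.1 hle)) (b r) x (fun p h => ((hTmem p).1 h).2)
    refine ⟨Function.update c r d, fun p hp hIp hxp hmem => ?_⟩
    have hKp : K ≤ p := by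
      refine sup_le hIp (Ideal.span_le.2 ?_)
      rintro y ⟨i, hi, rfl⟩
      have := hmem i (by omega)
      rwa [Function.update_of_ne (by omega)] at this
    obtain ⟨q, hq, hqp⟩ := Ideal.exists_minimalPrimes_le hKp
    have hqprime : q.IsPrime := hq.1.1
    have hxq : x ∉ q := fun h => hxp (hqp h)
    have hdq := hd q ((hTmem q).2 ⟨hq, hxq⟩)
    have hlt : q < p := by
      refine lt_of_le_of_ne hqp ?_
      rintro rfl
      have := hmem r (by omega)
      rw [Function.update_self] at this
      exact hdq this
    have h1 := hc q hqprime (le_sup_left.trans hq.1.2) hxq (fun i hi =>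
      hq.1.2 (Ideal.mem_sup_right (Ideal.subset_span ⟨i, hi, rfl⟩)))
    have h2 := Ideal.height_add_one_le_of_lt_of_isPrime hlt
    calc ((r + 1 + 1 : ℕ) : ℕ∞) = ((r + 1 : ℕ) : ℕ∞) + 1 := by push_cast; rfl
      _ ≤ q.height + 1 := by gcongr
      _ ≤ _ := h2

theorem ugp_local {B : Type*} [CommRing B] [IsNoetherianRing B] (n : ℕ)
    {Q : Type*} [AddCommGroup Q] [Module B Q] [Module.Finite B Q] [Module.Projective B Q]
    (P : PrimeSpectrum B) (hr : rankAt B Q P = n) :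
    ∃ s ∉ P.asIdeal, ∃ (φ : Q →ₗ[B] (Fin n → B)) (g : (Fin n → B) →ₗ[B] Q),
      (∀ v, φ (g v) = s • v) ∧ ∀ q, g (φ q) = s • q := by
  let S := P.asIdeal.primeCompl
  let R' := Localization.AtPrime P.asIdeal
  let M' := LocalizedModule S Q
  have : Module.Finite R' M' := inferInstance
  have : Module.Projective R' M' :=
    inferInstanceAs (Module.Projective (Localization S) (LocalizedModule S Q))
  have : Module.Free R' M' := Module.free_of_flat_of_isLocalRing
  have hr' : Module.finrank R' M' = n := hr
  let bas := Module.finBasisOfFinrankEq R' M' hr'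
  let e : M' ≃ₗ[B] (Fin n → R') := bas.equivFun.restrictScalars B
  let f : Q →ₗ[B] M' := LocalizedModule.mkLinearMap S Q
  let F : (Fin n → B) →ₗ[B] (Fin n → R') :=
    .pi fun i => (Algebra.linearMap B R') ∘ₗ LinearMap.proj i
  have : IsLocalizedModule S f := inferInstanceAs (IsLocalizedModule S (LocalizedModule.mkLinearMap S Q))
  have : IsLocalizedModule S F := IsLocalizedModule.pi S (fun _ : Fin n => Algebra.linearMap B R')
  have : Module.FinitePresentation B Q := Module.finitePresentation_of_finite B Q
  obtain ⟨φ, t, hφ⟩ := Module.FinitePresentation.exists_lift_of_isLocalizedModule S F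
    (e.toLinearMap ∘ₗ f)
  obtain ⟨g, u, hg⟩ := Module.FinitePresentation.exists_lift_of_isLocalizedModule S f
    (e.symm.toLinearMap ∘ₗ F)
  have hφ' : ∀ q, F (φ q) = (t : B) • e (f q) := fun q => LinearMap.congr_fun hφ q
  have hg' : ∀ v, f (g v) = (u : B) • e.symm (F v) := fun v => LinearMap.congr_fun hg v
  obtain ⟨v, hv⟩ := Module.Finite.exists_smul_of_comp_eq_of_isLocalizedModule S F (φ ∘ₗ g)
    (((t : B) * u) • LinearMap.id) (LinearMap.ext fun y => by
      simp [hφ', hg', mul_smul])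
  obtain ⟨w, hw⟩ := Module.Finite.exists_smul_of_comp_eq_of_isLocalizedModule S f (g ∘ₗ φ)
    (((t : B) * u) • LinearMap.id) (LinearMap.ext fun y => by
      simp [hφ', hg', mul_smul, smul_comm (t : B) (u : B)])
  have hv' : ∀ y, (v : B) • φ (g y) = (v : B) • ((t : B) * u) • y :=
    fun y => LinearMap.congr_fun hv y
  have hw' : ∀ y, (w : B) • g (φ y) = (w : B) • ((t : B) * u) • y :=
    fun y => LinearMap.congr_fun hw y
  refine ⟨(w : B) * v * (t * u), (w * v * (t * u)).2, ((w : B) * v) • φ, g, fun y => ?_, fun y => ?_⟩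
  · rw [LinearMap.smul_apply, mul_smul, hv', mul_smul ((w : B) * v), mul_smul (w : B)]
  · rw [LinearMap.smul_apply, map_smul, mul_comm (w : B), mul_smul, hw', mul_smul ((v : B) * w),
      mul_smul (v : B)]

theorem ugp_main (B : Type*) [CommRing B] [IsNoetherianRing B] (n : ℕ) (hdim : ringKrullDim B = n)
    (Q : Type*) [AddCommGroup Q] [Module B Q] [Module.Finite B Q] [Module.Projective B Q]
    (hrank : ∀ 𝔭 : PrimeSpectrum B, rankAt B Q 𝔭 = n)
    (a : B) (q : Q) (hum : IsUnimodular B ((a, q) : B × Q)) (I : Ideal B) :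
    (∀ 𝔭 ∈ minimalPrimes B, ¬ I ≤ 𝔭) → ∃ p : Q, orderIdeal B (q + a • p) ⊔ I = ⊤ := by
  classical
  induction I using IsNoetherian.induction with
  | hgt I ih =>
  intro hI
  by_cases htop : I = ⊤
  · exact ⟨0, by simp [htop]⟩
  obtain ⟨𝔪, h𝔪, hI𝔪⟩ := Ideal.exists_le_maximal I htop
  obtain ⟨s, hs, φ, g, hφg, hgφ⟩ := ugp_local (Q := Q) n ⟨𝔪, h𝔪.isPrime⟩ (hrank _)
  have hlt : I < I ⊔ Ideal.span {s} := by
    refine lt_of_le_of_ne le_sup_left (fun h => hs (hI𝔪 ?_))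
    rw [h]
    exact Ideal.mem_sup_right (Ideal.mem_span_singleton_self s)
  obtain ⟨p, hp⟩ := ih _ hlt (fun P hP hle => hI P hP (le_sup_left.trans hle))
  set q1 := q + a • p with hq1
  obtain ⟨c, hc⟩ := ugp_stable I hI (fun i => if h : i < n then φ q1 ⟨i, h⟩ else 0)
    (a * s ^ 2) n
  let y : Q := g (fun i => c i)
  refine ⟨p + s • y, ?_⟩
  have hq2 : q + a • (p + s • y) = q1 + (a * s) • y := by
    rw [hq1, smul_add, mul_smul, add_assoc]
  rw [hq2]
  by_contra hne
  obtain ⟨M, hM, hle⟩ := Ideal.exists_le_maximal _ hne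
  have hMp := hM.isPrime
  have hIM : I ≤ M := le_sup_right.trans hle
  have hψ : ∀ ψ : Q →ₗ[B] B, ψ (q1 + (a * s) • y) ∈ M := fun ψ =>
    hle (Ideal.mem_sup_left (Ideal.subset_span ⟨ψ, rfl⟩))
  have hcoord : ∀ i : Fin n, φ q1 i + a * s ^ 2 * c i ∈ M := by
    intro i
    have := hψ (LinearMap.proj i ∘ₗ φ)
    simp only [LinearMap.comp_apply, LinearMap.proj_apply, map_add, map_smul, y, hφg,
      Pi.add_apply, Pi.smul_apply, smul_eq_mul] at this
    convert this using 2
    ring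
  have hx : a * s ^ 2 ∈ M := by
    by_contra hx
    have h1 := hc M hMp hIM hx (fun i hi => by simpa [hi] using hcoord ⟨i, hi⟩)
    have h2 := Ideal.height_le_ringKrullDim_of_isPrime (I := M)
    rw [hdim] at h2
    have h3 : M.height ≤ (n : ℕ∞) := by exact_mod_cast h2
    have h4 : ((n + 1 : ℕ) : ℕ∞) ≤ (n : ℕ∞) := h1.trans h3
    have h5 : n + 1 ≤ n := by exact_mod_cast h4
    omega
  have hq1M : a * s ∈ M → ∀ ψ : Q →ₗ[B] B, ψ q1 ∈ M := by
    intro h ψ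
    have := hψ ψ
    rw [map_add, map_smul, smul_eq_mul] at this
    exact (Ideal.add_mem_iff_left M (M.mul_mem_right _ h)).1 this
  by_cases hsM : s ∈ M
  · apply hM.ne_top
    rw [eq_top_iff, ← hp]
    refine sup_le (Ideal.span_le.2 ?_) (sup_le hIM ((Ideal.span_singleton_le_iff_mem M).2 hsM))
    rintro z ⟨ψ, rfl⟩
    exact hq1M (M.mul_mem_left _ hsM) ψ
  · have haM : a ∈ M := by
      rcases hMp.mem_or_mem hx with h | h
      · exact h
      · exact absurd (hMp.mem_of_pow_mem _ h) hsM
    obtain ⟨ψ, hψ1⟩ := hum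
    have h1 : ψ (a, q) = a * ψ (1, 0) + ψ (0, q) := by
      rw [← smul_eq_mul, ← map_smul, ← map_add]; simp
    have h2 : ψ (0, q) ∈ M := by
      have h3 := hq1M (M.mul_mem_right _ haM) (ψ ∘ₗ LinearMap.inr B B Q)
      rw [hq1, map_add, map_smul, smul_eq_mul] at h3
      exact (Ideal.add_mem_iff_left M (M.mul_mem_right _ haM)).1 h3
    apply hM.ne_top
    rw [Ideal.eq_top_iff_one, ← hψ1, h1]
    exact M.add_mem (M.mul_mem_right _ haM) h2

theorem ugp_order_mem {B Q : Type*} [CommRing B] [AddCommGroup Q] [Module B Q] (q : Q) (x : B)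
    (hx : x ∈ orderIdeal B q) : ∃ ψ : Q →ₗ[B] B, ψ q = x := by
  have : orderIdeal B q ≤ LinearMap.range (LinearMap.applyₗ (R := B) (M₂ := B) q) := by
    refine Ideal.span_le.2 ?_
    rintro z ⟨ψ, rfl⟩
    exact ⟨ψ, rfl⟩
  obtain ⟨ψ, h⟩ := this hx
  exact ⟨ψ, h⟩

def ugpUp {B Q : Type*} [CommRing B] [AddCommGroup Q] [Module B Q] (ψ : Q →ₗ[B] B) :
    (B × Q) ≃ₗ[B] (B × Q) where
  toFun z := (z.1 + ψ z.2, z.2)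
  invFun z := (z.1 - ψ z.2, z.2)
  map_add' z w := by ext <;> simp; ring
  map_smul' z w := by ext <;> simp; ring
  left_inv z := by simp
  right_inv z := by simp

def ugpDown {B Q : Type*} [CommRing B] [AddCommGroup Q] [Module B Q] (p : Q) :
    (B × Q) ≃ₗ[B] (B × Q) where
  toFun z := (z.1, z.2 + z.1 • p)
  invFun z := (z.1, z.2 - z.1 • p)
  map_add' z w := by ext <;> simp [add_smul]; abel
  map_smul' z w := by ext <;> simp [mul_smul]
  left_inv z := by simp
  right_inv z := by simp

/-- Let `B` be a commutative Noetherian ring of dimension `n`, `Q` a finitely generated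
projective `B`-module of constant rank `n`, and `J` an ideal of height `≥ 1` (i.e. not
contained in any minimal prime).  For any unimodular `(a, q) ∈ B ⊕ Q` there is an automorphism
`Ψ` of `B ⊕ Q` with `(a, q)Ψ = (a₁, q̃)`, `a₁ ≡ 1 (mod J)` and `O(q̃) + J = B`. -/
theorem unimodular_good_position
    (B : Type*) [CommRing B] [IsNoetherianRing B] (n : ℕ) (hdim : ringKrullDim B = n)
    (Q : Type*) [AddCommGroup Q] [Module B Q] [Module.Finite B Q] [Module.Projective B Q]
    (hrank : ∀ 𝔭 : PrimeSpectrum B, rankAt B Q 𝔭 = n)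
    (J : Ideal B) (hJ : ∀ 𝔭 ∈ minimalPrimes B, ¬ J ≤ 𝔭)
    (a : B) (q : Q) (hum : IsUnimodular B ((a, q) : B × Q)) :
    ∃ Ψ : (B × Q) ≃ₗ[B] (B × Q),
      (Ψ (a, q)).1 - 1 ∈ J ∧ orderIdeal B (Ψ (a, q)).2 ⊔ J = ⊤ := by
  obtain ⟨p, hp⟩ := ugp_main B n hdim Q hrank a q hum J hJ
  have h1 : (1 : B) ∈ orderIdeal B (q + a • p) ⊔ J := hp ▸ Submodule.mem_top
  obtain ⟨x, hx, j, hj, hxj⟩ := Submodule.mem_sup.1 h1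
  obtain ⟨ψ, hψ⟩ := ugp_order_mem _ _ hx
  refine ⟨(ugpDown p).trans (ugpUp ((1 - a) • ψ)), ?_, hp⟩
  change a + (1 - a) * ψ (q + a • p) - 1 ∈ J
  rw [hψ]
  have : a + (1 - a) * x - 1 = (a - 1) * j := by linear_combination (1 - a) * hxj
  rw [this]
  exact J.mul_mem_left _ hj
end

section
/- Let B be an affine algebra over ℝ and let f ∈ B be an element not belonging to any real maximal ideal of B. Let K ⊆ B be an ideal and a ∈ B such that f^r ∈ Ba + K for some integer r. Then there exists h ∈ 1 + Bf such that ah > 0 on Z_r(K). Moreover, if I is any ideal of B such that f^l ∈ I + K for some positive integer l, then h can be chosen in 1 + If. -/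
section Helpers
open MvPolynomial Filter Topology


lemma L1 {A C : Type*} [CommRing A] [CommRing C] [Algebra A C] {n : ℕ} (x : Fin n → C) (e : ℕ)
    (q : Fin n → MvPolynomial (Fin n) A) (hq : ∀ i, (q i).totalDegree < e)
    (hx : ∀ i, x i ^ e = aeval x (q i)) (p : MvPolynomial (Fin n) A) :
    IsIntegral A (aeval x p) := by
  classical
  let b : Fin n →₀ ℕ := Finsupp.equivFunOnFinite.symm (fun _ => e)
  let mon : (Fin n →₀ ℕ) → C := fun s => aeval x (monomial s (1 : A))
  let M : Submodule A C := Submodule.span A (mon '' Set.Iic b)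
  have hmon : ∀ d : ℕ, ∀ s : Fin n →₀ ℕ, s.degree = d → mon s ∈ M := by
    intro d
    induction d using Nat.strong_induction_on with
    | _ d ih =>
      intro s hs
      by_cases h : s ≤ b
      · exact Submodule.subset_span ⟨s, h, rfl⟩
      · have : ∃ i, e < s i := by
          by_contra hc
          push Not at hc
          exact h (fun i => hc i)
        obtain ⟨i, hi⟩ := this
        have hle : Finsupp.single i e ≤ s := by
          rw [Finsupp.single_le_iff]; exact hi.le
        obtain ⟨s', hs'⟩ := exists_add_of_le hle
        have hdeg : e + s'.degree = d := by
          rw [← hs, hs']; simp [Finsupp.degree_single]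
        have h1 : mon s = aeval x (q i * monomial s' (1:A)) := by
          simp only [mon, map_mul, ← hx, hs']
          rw [← aeval_X (R := A) x i, ← map_pow, ← map_mul, X_pow_eq_monomial,
            monomial_mul, one_mul]
        have h2 : (q i * monomial s' (1:A)).totalDegree < d := by
          have := totalDegree_mul (q i) (monomial s' (1:A))
          have h3 : (monomial s' (1:A)).totalDegree ≤ s'.degree := totalDegree_monomial_le s' (1:A)
          have := hq i
          omega
        rw [h1, (q i * monomial s' (1:A)).as_sum, map_sum]
        refine Submodule.sum_mem _ fun t ht => ?_
        have ht' : t.degree < d := lt_of_le_of_lt (le_totalDegree ht) h2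
        have h5 : monomial t (coeff t (q i * monomial s' (1:A))) =
          (coeff t (q i * monomial s' (1:A))) • monomial t (1:A) := by
          rw [smul_monomial]; simp
        rw [h5, map_smul]
        exact M.smul_mem _ (ih _ ht' t rfl)
  have hall : ∀ p : MvPolynomial (Fin n) A, aeval x p ∈ M := by
    intro p
    rw [p.as_sum, map_sum]
    refine Submodule.sum_mem _ fun t ht => ?_
    have h5 : monomial t (coeff t p) = (coeff t p) • monomial t (1:A) := by
          rw [smul_monomial]; simp
    rw [h5, map_smul]
    exact M.smul_mem _ (hmon _ t rfl)
  have hM : M = Subalgebra.toSubmodule (aeval x : MvPolynomial (Fin n) A →ₐ[A] C).range := by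
    apply le_antisymm
    · apply Submodule.span_le.2
      rintro _ ⟨s, -, rfl⟩
      exact ⟨_, rfl⟩
    · rintro _ ⟨p, rfl⟩
      exact hall p
  have hfg : (Subalgebra.toSubmodule (aeval x : MvPolynomial (Fin n) A →ₐ[A] C).range).FG := by
    rw [← hM]
    exact Submodule.fg_span ((Set.finite_Iic b).image _)
  exact IsIntegral.of_mem_of_fg _ hfg _ ⟨p, rfl⟩

lemma L2d {n : ℕ} (x : Fin n → ℝ) (i : Fin n) (G : MvPolynomial (Fin n) ℝ) (t : ℝ) :
    HasDerivAt (fun t => eval (Function.update x i t) G)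
      (eval (Function.update x i t) (pderiv i G)) t := by
  induction G using MvPolynomial.induction_on with
  | C a => simpa using hasDerivAt_const t a
  | add p q hp hq => simp only [map_add]; exact hp.add hq
  | mul_X p j hp =>
    have hX : HasDerivAt (fun t => Function.update x i t j)
        (eval (Function.update x i t) (pderiv i (X j : MvPolynomial (Fin n) ℝ))) t := by
      by_cases h : j = i
      · subst h; simpa using hasDerivAt_id' t
      · simpa [h, pderiv_X, Pi.single_apply] using hasDerivAt_const t (x j)
    simp only [map_mul, eval_X, Derivation.leibniz, smul_eq_mul, map_add]
    refine (hp.mul hX).congr_deriv ?_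
    ring

lemma L2 {n : ℕ} (G : MvPolynomial (Fin n) ℝ) (R : ℝ) (hR : 0 < R) :
    ∃ x : Fin n → ℝ, (∀ i, |x i| ≤ R) ∧ (∀ y : Fin n → ℝ, (∀ i, |y i| ≤ R) → eval x G ≤ eval y G) ∧
      ∀ i, (R ^ 2 - x i ^ 2) * eval x (pderiv i G) = 0 := by
  classical
  let K : Set (Fin n → ℝ) := Set.pi Set.univ fun _ => Set.Icc (-R) R
  have hK : IsCompact K := isCompact_univ_pi fun _ => isCompact_Icc
  have hne : K.Nonempty := ⟨0, fun i _ => by simp [hR.le]⟩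
  obtain ⟨x, hx, hmin⟩ := hK.exists_isMinOn hne (MvPolynomial.continuous_eval G).continuousOn
  have hx' : ∀ i, |x i| ≤ R := fun i => abs_le.2 (hx i trivial)
  refine ⟨x, hx', fun y hy => hmin (fun i _ => abs_le.1 (hy i)), fun i => ?_⟩
  by_cases h : |x i| = R
  · rw [← h, sq_abs]; simp
  · have hlt : |x i| < R := lt_of_le_of_ne (hx' i) h
    have hd := L2d x i G (x i)
    rw [Function.update_eq_self] at hd
    have hloc : IsLocalMin (fun t => eval (Function.update x i t) G) (x i) := by
      have : ∀ᶠ t in nhds (x i), t ∈ Set.Ioo (-R) R :=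
        Ioo_mem_nhds (abs_lt.1 hlt).1 (abs_lt.1 hlt).2
      filter_upwards [this] with t ht
      rw [Function.update_eq_self]
      apply hmin
      intro j _
      by_cases hj : j = i
      · subst hj; simpa using ⟨ht.1.le, ht.2.le⟩
      · simpa [hj] using hx j trivial
    rw [hloc.hasDerivAt_eq_zero hd, mul_zero]

lemma L3 (p : Polynomial (Polynomial (Polynomial ℝ))) (R Y m : ℝ) :
    (Polynomial.Bivariate.swap p).eval₂ (Polynomial.evalEvalRingHom R m) Y
      = p.eval₂ (Polynomial.evalEvalRingHom R Y) m := by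
  induction p using Polynomial.induction_on' with
  | add p q hp hq => simp only [map_add, Polynomial.eval₂_add, hp, hq]
  | monomial k a =>
    induction a using Polynomial.induction_on' with
    | add p q hp hq => simp only [map_add, Polynomial.eval₂_add, hp, hq]
    | monomial j a =>
      rw [Polynomial.Bivariate.swap_monomial_monomial]
      simp only [Polynomial.eval₂_monomial]
      simp [Polynomial.eval_monomial]
      ring

lemma L4 (P : Polynomial (Polynomial (Polynomial ℝ))) (R m0 : ℝ) (m : ℝ → ℝ)
    (hm : Tendsto m atTop (𝓝 m0))
    (h : ∀ Y > 0, P.eval₂ (Polynomial.evalEvalRingHom R (m Y)) Y = 0) :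
    Polynomial.evalEval R m0 P.leadingCoeff = 0 := by
  have hc : ∀ c : Polynomial (Polynomial ℝ),
      Tendsto (fun Y => Polynomial.evalEval R (m Y) c) atTop (𝓝 (Polynomial.evalEval R m0 c)) := by
    intro c
    simp only [← Polynomial.map_evalRingHom_eval]
    exact ((Polynomial.continuous _).tendsto m0).comp hm
  have h1 : ∀ j ∈ Finset.range P.natDegree, Tendsto (fun Y : ℝ => 
      Polynomial.evalEval R (m Y) (P.coeff j) * (Y ^ j / Y ^ P.natDegree)) atTop (𝓝 0) := by
    intro j hj
    have := (hc (P.coeff j)).mul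
      (tendsto_pow_div_pow_atTop_zero (𝕜 := ℝ) (Finset.mem_range.1 hj))
    simpa using this
  have h2 := tendsto_finsetSum _ h1
  have h3 := (hc P.leadingCoeff).add h2
  simp only [Finset.sum_const_zero, add_zero] at h3
  refine tendsto_nhds_unique h3 ?_
  refine tendsto_const_nhds.congr' ?_
  filter_upwards [eventually_gt_atTop 0] with Y hY
  have := h Y hY
  rw [Polynomial.eval₂_eq_sum_range, Finset.sum_range_succ] at this
  have hY' : Y ^ P.natDegree ≠ 0 := by positivity
  have h5 : (Polynomial.evalEval R (m Y) P.leadingCoeff + ∑ j ∈ Finset.range P.natDegree,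
     Polynomial.evalEval R (m Y) (P.coeff j) * (Y ^ j / Y ^ P.natDegree)) * Y ^ P.natDegree = 0 := by
    rw [← this, add_mul, Finset.sum_mul, add_comm]
    congr 1
    refine Finset.sum_congr rfl fun j _ => ?_
    rw [mul_assoc, div_mul_cancel₀ _ hY']
    rfl
  exact ((mul_eq_zero.1 h5).resolve_right hY').symm

lemma L6a (p : Polynomial ℝ) : ∃ c : ℝ, 0 ≤ c ∧ ∃ N : ℕ, ∀ R : ℝ, 1 ≤ R → |p.eval R| ≤ c * R ^ N := by
  refine ⟨∑ j ∈ Finset.range (p.natDegree + 1), |p.coeff j|, by positivity, p.natDegree, ?_⟩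
  intro R hR
  rw [Polynomial.eval_eq_sum_range, Finset.sum_mul]
  refine (Finset.abs_sum_le_sum_abs _ _).trans (Finset.sum_le_sum fun j hj => ?_)
  rw [abs_mul, abs_of_nonneg (by positivity : 0 ≤ R ^ j)]
  have : j ≤ p.natDegree := by simpa [Nat.lt_succ_iff] using hj
  gcongr

lemma L6 (q : Polynomial (Polynomial ℝ)) (M : ℝ) : ∃ c : ℝ, 0 ≤ c ∧ ∃ N : ℕ, ∀ R m : ℝ, 1 ≤ R →
    |m| ≤ M → |Polynomial.evalEval R m q| ≤ c * R ^ N := by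
  induction q using Polynomial.induction_on' with
  | add p q hp hq =>
    obtain ⟨c, hc, N, h⟩ := hp
    obtain ⟨c', hc', N', h'⟩ := hq
    refine ⟨c + c', by positivity, N + N', fun R m hR hm => ?_⟩
    rw [Polynomial.evalEval_add]
    refine (abs_add_le _ _).trans ?_
    have h1 : c * R ^ N ≤ c * R ^ (N + N') := by gcongr; omega
    have h2 : c' * R ^ N' ≤ c' * R ^ (N + N') := by gcongr; omega
    linarith [h R m hR hm, h' R m hR hm]
  | monomial k a =>
    obtain ⟨c, hc, N, h⟩ := L6a a
    refine ⟨c * |M| ^ k, by positivity, N, fun R m hR hm => ?_⟩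
    have : Polynomial.evalEval R m (Polynomial.monomial k a) = a.eval R * m ^ k := by
      simp [Polynomial.evalEval]
    rw [this, abs_mul, abs_pow, mul_right_comm]
    have : |m| ≤ |M| := hm.trans (le_abs_self M)
    gcongr
    exact h R hR

lemma L6b (p : Polynomial ℝ) (hp : p ≠ 0) : ∃ c : ℝ, 0 < c ∧ ∀ᶠ R in atTop, c ≤ |p.eval R| := by
  by_cases h : 0 < p.degree
  · exact ⟨1, one_pos, (p.abs_tendsto_atTop h).eventually_ge_atTop 1⟩
  · have := Polynomial.eq_C_of_degree_le_zero (not_lt.1 h)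
    refine ⟨|p.coeff 0|, ?_, Eventually.of_forall fun R => ?_⟩
    · rw [abs_pos]; intro h0; rw [h0] at this; simp at this; exact hp this
    · rw [this]; simp

lemma L5 (q : Polynomial (Polynomial ℝ)) (hq : q ≠ 0) (m : ℝ → ℝ) (M : ℝ)
    (hm : ∀ R, 1 ≤ R → 0 < m R ∧ m R ≤ M)
    (h : ∀ R, 1 ≤ R → Polynomial.evalEval R (m R) q = 0) :
    ∃ R0 : ℝ, 1 ≤ R0 ∧ ∃ c : ℝ, 0 < c ∧ ∃ N : ℕ, ∀ R, R0 ≤ R → c ≤ m R * R ^ N := by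
  obtain ⟨q', hq', hnd⟩ := Polynomial.exists_eq_pow_rootMultiplicity_mul_and_not_dvd q hq 0
  set k := q.rootMultiplicity 0
  simp only [Polynomial.C_0, sub_zero] at hq' hnd
  rw [Polynomial.X_dvd_iff] at hnd
  obtain ⟨c, hc, hev⟩ := L6b _ hnd
  obtain ⟨d, hd, N, hb⟩ := L6 q'.divX M
  obtain ⟨R1, hR1⟩ := eventually_atTop.1 hev
  refine ⟨max R1 1, le_max_right _ _, c / (d + 1), by positivity, N, fun R hR => ?_⟩
  have h1 : 1 ≤ R := (le_max_right _ _).trans hR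
  have h2 := hR1 R ((le_max_left _ _).trans hR)
  obtain ⟨hm0, hmM⟩ := hm R h1
  have h3 := hb R (m R) h1 (by rwa [abs_of_pos hm0])
  have h4 := h R h1
  have h5 : Polynomial.evalEval R (m R) q' = 0 := by
    rw [hq', Polynomial.evalEval_mul, Polynomial.evalEval_pow, Polynomial.evalEval_X] at h4
    exact (mul_eq_zero.1 h4).resolve_left (pow_ne_zero _ hm0.ne')
  rw [← Polynomial.divX_mul_X_add q', Polynomial.evalEval_add, Polynomial.evalEval_mul,
    Polynomial.evalEval_X, Polynomial.evalEval_C] at h5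
  have h6 : |(q'.coeff 0).eval R| = |Polynomial.evalEval R (m R) q'.divX| * m R := by
    rw [← abs_of_pos hm0, ← abs_mul, ← abs_neg, abs_of_pos hm0]; congr 1; linarith
  rw [div_le_iff₀ (by positivity)]
  have h7 : |Polynomial.evalEval R (m R) q'.divX| * m R ≤ (d * R ^ N) * m R := by gcongr
  have h8 : 0 < m R * R ^ N := by positivity
  nlinarith

lemma L7a {n : ℕ} (F : MvPolynomial (Fin n) ℝ) :
    ∃ x : ℝ → ℝ → Fin n → ℝ, ∃ x0 : ℝ → Fin n → ℝ,
      (∀ R, 0 < R → ∀ y : Fin n → ℝ, (∀ i, |y i| ≤ R) → eval (x0 R) F ≤ eval y F) ∧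
      (∀ R, 0 < R → Tendsto (fun Y => eval (x R Y) F) atTop (𝓝 (eval (x0 R) F))) ∧
      ∃ p : Polynomial (Polynomial (Polynomial ℝ)), p ≠ 0 ∧ ∀ R Y, 0 < R → 0 < Y →
        p.eval₂ (Polynomial.evalEvalRingHom R Y) (eval (x R Y) F) = 0 := by
  classical
  let E : ℕ := ∑ i, (pderiv i F).totalDegree + 1
  have hE : ∀ i, (pderiv i F).totalDegree + 1 ≤ E := fun i => by
    have := Finset.single_le_sum (f := fun i => (pderiv i F).totalDegree)
      (fun i _ => Nat.zero_le _) (Finset.mem_univ i)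
    simp only [E]; omega
  let H : MvPolynomial (Fin n) ℝ := ∑ i, X i ^ (E + 1)
  let G : ℝ → MvPolynomial (Fin n) ℝ := fun Y => F + C Y⁻¹ * H
  have hHd : ∀ i, pderiv i H = C ((E : ℝ) + 1) * X i ^ E := by
    intro i
    simp only [H, map_sum]
    rw [Finset.sum_eq_single i]
    · simp [pderiv_pow]
    · intro j _ hj
      simp [pderiv_pow, pderiv_X, Pi.single_apply, hj]
    · simp
  have e1 : ∀ R Y : ℝ, ∃ x : Fin n → ℝ, 0 < R → (∀ i, |x i| ≤ R) ∧
      (∀ y : Fin n → ℝ, (∀ i, |y i| ≤ R) → eval x (G Y) ≤ eval y (G Y)) ∧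
      ∀ i, (R ^ 2 - x i ^ 2) * eval x (pderiv i (G Y)) = 0 := by
    intro R Y
    by_cases hR : 0 < R
    · obtain ⟨x, hx⟩ := L2 (G Y) R hR
      exact ⟨x, fun _ => hx⟩
    · exact ⟨0, fun h => absurd h hR⟩
  have e0 : ∀ R : ℝ, ∃ x : Fin n → ℝ, 0 < R → (∀ i, |x i| ≤ R) ∧
      (∀ y : Fin n → ℝ, (∀ i, |y i| ≤ R) → eval x F ≤ eval y F) := by
    intro R
    by_cases hR : 0 < R
    · obtain ⟨x, hx⟩ := L2 F R hR
      exact ⟨x, fun _ => ⟨hx.1, hx.2.1⟩⟩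
    · exact ⟨0, fun h => absurd h hR⟩
  choose x hx using e1
  choose x0 hx0 using e0
  refine ⟨x, x0, fun R hR => (hx0 R hR).2, fun R hR => ?_, ?_⟩
  · have hHb : ∀ y : Fin n → ℝ, (∀ i, |y i| ≤ R) → |eval y H| ≤ n * R ^ (E + 1) := by
      intro y hy
      simp only [H, map_sum, map_pow, eval_X]
      refine (Finset.abs_sum_le_sum_abs _ _).trans ?_
      refine (Finset.sum_le_card_nsmul _ _ (R ^ (E + 1)) ?_).trans (by simp)
      intro i _
      rw [abs_pow]
      exact pow_le_pow_left₀ (abs_nonneg _) (hy i) _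
    have hlim : Tendsto (fun Y : ℝ => eval (x0 R) F + Y⁻¹ * (2 * (n * R ^ (E + 1)))) atTop
        (𝓝 (eval (x0 R) F)) := by
      have := (tendsto_inv_atTop_zero (𝕜 := ℝ)).mul_const (2 * (n * R ^ (E + 1)))
      simpa using this.const_add (eval (x0 R) F)
    refine tendsto_of_tendsto_of_tendsto_of_le_of_le' tendsto_const_nhds hlim ?_ ?_
    · exact Eventually.of_forall fun Y => (hx0 R hR).2 _ (hx R Y hR).1
    · filter_upwards [eventually_gt_atTop 0] with Y hY
      have h1 := (hx R Y hR).2.1 _ (hx0 R hR).1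
      simp only [G, map_add, map_mul, eval_C] at h1
      have h2 := abs_le.1 (hHb _ (hx0 R hR).1)
      have h3 := abs_le.1 (hHb _ (hx R Y hR).1)
      have hY' : 0 < Y⁻¹ := by positivity
      nlinarith
  · let S := {s : ℝ × ℝ // 0 < s.1 ∧ 0 < s.2}
    let ψ : Polynomial (Polynomial ℝ) →+* (S → ℝ) :=
      RingHom.pi fun s => Polynomial.evalEvalRingHom s.1.1 s.1.2
    let _ := ψ.toAlgebra
    let ξ : Fin n → (S → ℝ) := fun i s => x s.1.1 s.1.2 i
    let κ : ℝ →+* Polynomial (Polynomial ℝ) := Polynomial.C.comp Polynomial.C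
    let Rp : Polynomial (Polynomial ℝ) := Polynomial.C Polynomial.X
    let Yp : Polynomial (Polynomial ℝ) := Polynomial.X
    let q : Fin n → MvPolynomial (Fin n) (Polynomial (Polynomial ℝ)) := fun i =>
      C (Rp ^ 2) * X i ^ E + C (Yp * κ ((E : ℝ) + 1)⁻¹) *
        ((C (Rp ^ 2) - X i ^ 2) * map κ (pderiv i F))
    have hev : ∀ (p : MvPolynomial (Fin n) (Polynomial (Polynomial ℝ))) (s : S),
        aeval ξ p s = eval₂ (Polynomial.evalEvalRingHom s.1.1 s.1.2) (x s.1.1 s.1.2) p := by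
      intro p s
      induction p using MvPolynomial.induction_on with
      | C a => simp only [aeval_C, eval₂_C]; rfl
      | add p q hp hq => simp only [map_add, Pi.add_apply, hp, hq, eval₂_add]
      | mul_X p j hp => simp only [map_mul, Pi.mul_apply, hp, eval₂_mul, aeval_X, eval₂_X]; rfl
    have hmap : ∀ (p : MvPolynomial (Fin n) ℝ) (R Y : ℝ) (y : Fin n → ℝ),
        eval₂ (Polynomial.evalEvalRingHom R Y) y (map κ p) = eval y p := by
      intro p R Y y
      rw [eval₂_map]
      have : (Polynomial.evalEvalRingHom R Y).comp κ = RingHom.id ℝ := by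
        ext c; simp [κ]
      rw [this]; rfl
    have hq : ∀ i, (q i).totalDegree < E + 2 := by
      intro i
      have t1 : (C (Rp ^ 2) * X i ^ E : MvPolynomial (Fin n) (Polynomial (Polynomial ℝ))).totalDegree
          ≤ E := by
        refine (totalDegree_mul _ _).trans ?_
        rw [totalDegree_C, totalDegree_X_pow]; omega
      have t2 : (C (Rp ^ 2) - X i ^ 2 :
          MvPolynomial (Fin n) (Polynomial (Polynomial ℝ))).totalDegree ≤ 2 := by
        refine (totalDegree_sub _ _).trans ?_
        rw [totalDegree_C, totalDegree_X_pow]; simp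
      have t3 : (map κ (pderiv i F)).totalDegree ≤ (pderiv i F).totalDegree :=
        Finset.sup_mono (support_map_subset _ _)
      have t4 := hE i
      have t5 := totalDegree_mul (C (Rp ^ 2) - X i ^ 2) (map κ (pderiv i F))
      have t6 := totalDegree_mul (C (Yp * κ ((E : ℝ) + 1)⁻¹))
        ((C (Rp ^ 2) - X i ^ 2) * map κ (pderiv i F))
      rw [totalDegree_C] at t6
      refine lt_of_le_of_lt (totalDegree_add _ _) (max_lt ?_ ?_) <;> omega
    have hξ : ∀ i, ξ i ^ (E + 2) = aeval ξ (q i) := by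
      intro i
      funext s
      rw [hev]
      obtain ⟨⟨R, Y⟩, hR, hY⟩ := s
      simp only at hR hY
      have h1 := (hx R Y hR).2.2 i
      simp only [G, map_add, Derivation.leibniz, hHd, smul_eq_mul, pderiv_C, mul_zero, add_zero,
        map_mul, eval_C, map_pow, eval_X] at h1
      simp only [q, eval₂_add, eval₂_mul, eval₂_C, eval₂_pow, eval₂_X, eval₂_sub, hmap]
      have hR' : Polynomial.evalEvalRingHom R Y Rp = R := by simp [Rp]
      have hY' : Polynomial.evalEvalRingHom R Y Yp = Y := by simp [Yp]
      have hκ : ∀ c, Polynomial.evalEvalRingHom R Y (κ c) = c := by intro c; simp [κ]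
      rw [map_mul, map_pow, hR', hY', hκ]
      change x R Y i ^ (E + 2) = _
      have hE1 : (E : ℝ) + 1 ≠ 0 := by positivity
      field_simp at h1 ⊢
      linear_combination (-1) * h1
    have hint := L1 ξ (E + 2) q hq hξ (map κ F)
    obtain ⟨p, hp, hp0⟩ := hint
    refine ⟨p, hp.ne_zero, fun R Y hR hY => ?_⟩
    have h2 := congrFun hp0 ⟨(R, Y), hR, hY⟩
    have h3 := Polynomial.hom_eval₂ p (algebraMap _ (S → ℝ))
      (Pi.evalRingHom (fun _ : S => ℝ) ⟨(R, Y), hR, hY⟩) (aeval ξ (map κ F))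
    rw [Pi.evalRingHom_apply, Pi.evalRingHom_apply, h2, hev, hmap] at h3
    exact h3.symm

lemma L7 {n : ℕ} (F : MvPolynomial (Fin n) ℝ) (hF : ∀ x, 0 < eval x F) :
    ∃ g : MvPolynomial (Fin n) ℝ, ∀ x, 1 ≤ eval x F * eval x g := by
  obtain ⟨x, x0, hmin, hlim, p, hp, hp0⟩ := L7a F
  let P := Polynomial.Bivariate.swap p
  have hP : P ≠ 0 := by
    simpa [P] using hp
  have hR : ∀ R, 1 ≤ R → Polynomial.evalEval R (eval (x0 R) F) P.leadingCoeff = 0 := by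
    intro R hR
    have hR0 : 0 < R := by linarith
    refine L4 P R _ _ (hlim R hR0) fun Y hY => ?_
    rw [L3]
    exact hp0 R Y hR0 hY
  obtain ⟨R0, hR0, c, hc, N, hb⟩ := L5 _ (Polynomial.leadingCoeff_ne_zero.2 hP)
    (fun R => eval (x0 R) F) (eval 0 F)
    (fun R hR => ⟨hF _, hmin R (by linarith) 0 (fun i => by simp; linarith)⟩) hR
  refine ⟨C c⁻¹ * (C R0 + ∑ i, X i ^ 2) ^ N, fun y => ?_⟩
  simp only [map_mul, eval_C, map_pow, map_add, map_sum, eval_X]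
  have hs : 0 ≤ ∑ i, y i ^ 2 := Finset.sum_nonneg fun i _ => sq_nonneg _
  have h1 := hb (R0 + ∑ i, y i ^ 2) (by linarith)
  have h2 := hmin (R0 + ∑ i, y i ^ 2) (by linarith) y (fun i => by
    have := Finset.single_le_sum (f := fun i => y i ^ 2) (fun i _ => sq_nonneg _)
      (Finset.mem_univ i)
    have h3 := sq_abs (y i)
    nlinarith [sq_nonneg (|y i| - 1)])
  have h3 : c ≤ eval y F * (R0 + ∑ i, y i ^ 2) ^ N := h1.trans (by gcongr)
  calc 1 = c⁻¹ * c := by field_simp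
    _ ≤ c⁻¹ * (eval y F * (R0 + ∑ i, y i ^ 2) ^ N) := by gcongr
    _ = _ := by ring

lemma L8 (B : Type*) [CommRing B] [Algebra ℝ B] [Algebra.FiniteType ℝ B]
    (f : B) (hf : ∀ φ : B →ₐ[ℝ] ℝ, φ f ≠ 0) :
    ∃ u : B, ∀ φ : B →ₐ[ℝ] ℝ, 1 ≤ φ f ^ 2 * φ u := by
  obtain ⟨n, π, hπ⟩ := Algebra.FiniteType.iff_quotient_mvPolynomial''.1
    (inferInstance : Algebra.FiniteType ℝ B)
  obtain ⟨f0, rfl⟩ := hπ f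
  obtain ⟨s, hs⟩ := (inferInstance : IsNoetherianRing (MvPolynomial (Fin n) ℝ)).noetherian
    (RingHom.ker π)
  have hF : ∀ x, 0 < eval x (f0 ^ 2 + ∑ p ∈ s, p ^ 2) := by
    intro x
    simp only [map_add, map_pow, map_sum]
    have hs0 : 0 ≤ ∑ p ∈ s, eval x p ^ 2 := Finset.sum_nonneg fun i _ => sq_nonneg _
    by_contra hc
    have h1 : eval x f0 ^ 2 = 0 := by nlinarith [sq_nonneg (eval x f0)]
    have h2 : ∑ p ∈ s, eval x p ^ 2 = 0 := by nlinarith [sq_nonneg (eval x f0)]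
    rw [Finset.sum_eq_zero_iff_of_nonneg (fun i _ => sq_nonneg _)] at h2
    have hker : RingHom.ker π ≤ RingHom.ker (aeval x : MvPolynomial (Fin n) ℝ →ₐ[ℝ] ℝ) := by
      rw [← hs]
      refine Submodule.span_le.2 fun p hp => ?_
      have := h2 p hp
      simpa [RingHom.mem_ker, aeval_eq_eval] using this
    let φ : B →ₐ[ℝ] ℝ := (Ideal.Quotient.liftₐ (RingHom.ker π) (aeval x)
      (fun a ha => hker ha)).comp (Ideal.quotientKerAlgEquivOfSurjective hπ).symm.toAlgHom
    apply hf φ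
    have h3 : (Ideal.quotientKerAlgEquivOfSurjective hπ).symm (π f0)
        = Ideal.Quotient.mk (RingHom.ker π) f0 := by
      rw [AlgEquiv.symm_apply_eq]; rfl
    have h4 : φ (π f0) = aeval x f0 := by
      change (Ideal.Quotient.liftₐ (RingHom.ker π) (aeval x) (fun a ha => hker ha))
        ((Ideal.quotientKerAlgEquivOfSurjective hπ).symm (π f0)) = _
      rw [h3]; rfl
    rw [h4, aeval_eq_eval]
    simpa using h1
  obtain ⟨g, hg⟩ := L7 _ hF
  refine ⟨π g, fun φ => ?_⟩
  have hφ : ∀ p, φ (π p) = eval (fun i => φ (π (X i))) p := by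
    intro p
    have := MvPolynomial.aeval_unique (φ.comp π)
    have h2 := DFunLike.congr_fun this p
    rw [aeval_eq_eval] at h2
    exact h2
  have h1 := hg (fun i => φ (π (X i)))
  rw [← hφ, ← hφ] at h1
  have h2 : π (f0 ^ 2 + ∑ p ∈ s, p ^ 2) = π f0 ^ 2 := by
    rw [map_add, map_sum, Finset.sum_eq_zero, add_zero, map_pow]
    intro p hp
    have : p ∈ RingHom.ker π := by rw [← hs]; exact Submodule.subset_span hp
    rw [map_pow, (RingHom.mem_ker).1 this]; simp
  rw [h2, map_pow] at h1
  exact h1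

lemma L9 (B : Type*) [CommRing B] [Algebra ℝ B] [Algebra.FiniteType ℝ B]
    (f : B) (hf : ∀ φ : B →ₐ[ℝ] ℝ, φ f ≠ 0)
    (K : Ideal B) (a : B) (r : ℕ) (hr : f ^ r ∈ Ideal.span {a} + K)
    (I : Ideal B) (l : ℕ) (hl : f ^ l ∈ I + K) :
      ∃ h : B, (∃ x ∈ I, h = 1 + x * f) ∧
        ∀ φ : B →ₐ[ℝ] ℝ, (∀ x ∈ K, φ x = 0) → 0 < φ (a * h) := by
  obtain ⟨u, hu⟩ := L8 B f hf
  obtain ⟨x, hx, k, hk, hxk⟩ := Submodule.mem_sup.1 hl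
  obtain ⟨y, hy, k', hk', hyk⟩ := Submodule.mem_sup.1 hr
  obtain ⟨b, rfl⟩ := Ideal.mem_span_singleton'.1 hy
  refine ⟨_, ⟨(a * x * f * (((b * f ^ r) ^ 2 + 1) * u ^ (r + l + 1))) * x,
    I.mul_mem_left _ hx, rfl⟩, fun φ hφ => ?_⟩
  have h1 : φ x = φ f ^ l := by
    rw [← map_pow, ← hxk, map_add, hφ k hk, add_zero]
  have h2 : φ b * φ a = φ f ^ r := by
    rw [← map_pow, ← hyk, map_add, hφ k' hk', add_zero, map_mul]
  have h3 := hu φ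
  simp only [map_mul, map_add, map_one, map_pow, h1]
  set A := φ a
  set t := φ f
  set U := φ u
  set β := φ b
  have h4 : 1 ≤ (t ^ 2 * U) ^ (r + l + 1) := one_le_pow₀ h3
  set W := t ^ (2 * l + 2) * U ^ (r + l + 1) with hW
  have h5 : t ^ (2 * r) * W = (t ^ 2 * U) ^ (r + l + 1) := by rw [hW]; ring
  have h6 : (β * t ^ r) * A = t ^ (2 * r) := by
    rw [mul_right_comm, h2]; ring
  have hA : A ≠ 0 := by
    intro h0
    rw [h0, mul_zero] at h2
    have : t ≠ 0 := hf φ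
    exact pow_ne_zero r this h2.symm
  set γ := β * t ^ r
  have h7 : A * (1 + A * t ^ l * t * ((γ ^ 2 + 1) * U ^ (r + l + 1)) * t ^ l * t)
      = A + A ^ 2 * (γ ^ 2 + 1) * W := by rw [hW]; ring
  rw [h7]
  have h8 : 1 ≤ γ * A * W := by rw [h6, h5]; exact h4
  have hWp : 0 < W := by
    have : 0 ≤ t ^ (2 * r) := by rw [pow_mul]; positivity
    by_contra hc
    rw [← h5] at h4
    nlinarith
  have hAp : 0 < |A| := abs_pos.2 hA
  have h9 : |A| < A ^ 2 * (γ ^ 2 + 1) * W := by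
    have e1 : 1 ≤ |γ| * |A| * W := h8.trans (by
      rw [← abs_mul]; exact mul_le_mul_of_nonneg_right (le_abs_self _) hWp.le)
    have e2 : 2 * |γ| ≤ γ ^ 2 + 1 := by
      rw [← sq_abs γ]; nlinarith [sq_nonneg (|γ| - 1)]
    have e3 : 1 < |A| * (γ ^ 2 + 1) * W := by
      have : |A| * (2 * |γ|) * W ≤ |A| * (γ ^ 2 + 1) * W := by gcongr
      nlinarith
    rw [← sq_abs A]
    nlinarith
  linarith [neg_abs_le A]


end Helpers

/-- Let `B` be an affine algebra over `ℝ` (real points of `Spec B` being identified with the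
`ℝ`-algebra homomorphisms `B → ℝ`) and `f ∈ B` not belonging to any real maximal ideal.  Let
`K ⊆ B` be an ideal and `a ∈ B` with `f^r ∈ Ba + K` for some `r`.  Then there is
`h ∈ 1 + Bf` with `ah > 0` on `Z_r(K)`; moreover for any ideal `I` with `f^l ∈ I + K` for
some `l`, one can choose `h ∈ 1 + If`. -/
theorem positive_on_real_zero_set
    (B : Type*) [CommRing B] [Algebra ℝ B] [Algebra.FiniteType ℝ B]
    (f : B) (hf : ∀ φ : B →ₐ[ℝ] ℝ, φ f ≠ 0)
    (K : Ideal B) (a : B) (r : ℕ) (hr : f ^ r ∈ Ideal.span {a} + K) :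
    (∃ h : B, (∃ b : B, h = 1 + b * f) ∧
      ∀ φ : B →ₐ[ℝ] ℝ, (∀ x ∈ K, φ x = 0) → 0 < φ (a * h)) ∧
    (∀ I : Ideal B, (∃ l : ℕ, 0 < l ∧ f ^ l ∈ I + K) →
      ∃ h : B, (∃ x ∈ I, h = 1 + x * f) ∧
        ∀ φ : B →ₐ[ℝ] ℝ, (∀ x ∈ K, φ x = 0) → 0 < φ (a * h)) := by
  refine ⟨?_, fun I ⟨l, _, hl⟩ => L9 B f hf K a r hr I l hl⟩
  obtain ⟨h, ⟨x, _, hx⟩, hpos⟩ := L9 B f hf K a r hr ⊤ 0 (by simp)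
  exact ⟨h, ⟨x, hx⟩, hpos⟩
end

section
/- Let B be an affine algebra over ℝ and X = Spec B. Let f ∈ B be such that f > 0 on X(ℝ). Let K ⊆ B be an ideal and let a₁ ∈ B be such that a₁ > 0 on Z_r(K). Then there exists c ∈ K such that a₁ + c > 0 on X(ℝ). Moreover, if J is any ideal of B such that f^q − a₁ ∈ J for some positive integer q, then c can be chosen in KJ. -/
open scoped IntermediateField

lemma aux_alg_of_D_eq_zero {k L : Type} [Field k] [CharZero k] [Field L] [Algebra k L]
    [Algebra.EssFiniteType k L] (y : L) (h : KaehlerDifferential.D k L y = 0) :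
    IsAlgebraic k y := by
  let E := k⟮y⟯
  have : CharZero E := charZero_of_injective_algebraMap (algebraMap k E).injective
  have h1 : Algebra.EssFiniteType E L := Algebra.EssFiniteType.of_comp k E L
  have h2 : Algebra.FormallySmooth E L := inferInstance
  have hE : Algebra.EssFiniteType k E := by
    rw [IntermediateField.essFiniteType_iff]
    exact ⟨{y}, by simp [E]⟩
  have hinj : Function.Injective (KaehlerDifferential.mapBaseChange k E L) := by
    rw [injective_iff_map_eq_zero]
    intro z hz
    obtain ⟨w, rfl⟩ := (Algebra.H1Cotangent.exact_δ_mapBaseChange k E L z).1 hz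
    have := h2.subsingleton_h1Cotangent
    rw [Subsingleton.elim w 0, map_zero]
  let yE : E := ⟨y, IntermediateField.mem_adjoin_simple_self k y⟩
  have hy : KaehlerDifferential.D k E yE = 0 := by
    have h3 : KaehlerDifferential.mapBaseChange k E L (1 ⊗ₜ KaehlerDifferential.D k E yE) = 0 := by
      simp only [KaehlerDifferential.mapBaseChange_tmul, KaehlerDifferential.map_D, one_smul]
      exact h
    have h4 := hinj (h3.trans (map_zero _).symm)
    have hf : Function.Injective (TensorProduct.mk E L (Ω[E⁄k]) 1) :=
      Module.FaithfullyFlat.tensorProduct_mk_injective _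
    exact hf (by simpa using h4)
  have hall : ∀ x : E, KaehlerDifferential.D k E x = 0 := by
    rintro ⟨x, hx⟩
    induction hx using IntermediateField.adjoin_induction with
    | mem x hx =>
      obtain rfl : x = y := by simpa using hx
      exact hy
    | algebraMap x => exact (KaehlerDifferential.D k E).map_algebraMap x
    | add x z hx hz h1 h2 =>
      have := (KaehlerDifferential.D k E).map_add ⟨x, hx⟩ ⟨z, hz⟩
      rw [h1, h2, add_zero] at this
      exact this
    | inv x hx h1 =>
      have := (KaehlerDifferential.D k E).leibniz_inv ⟨x, hx⟩
      rw [h1, smul_zero] at this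
      exact this
    | mul x z hx hz h1 h2 =>
      have := (KaehlerDifferential.D k E).leibniz ⟨x, hx⟩ ⟨z, hz⟩
      rw [h1, h2, smul_zero, smul_zero, add_zero] at this
      exact this
  have hU : Algebra.FormallyUnramified k E := by
    constructor
    have hs : Subsingleton (Submodule E (Ω[E⁄k])) := by
      apply subsingleton_of_bot_eq_top
      rw [← KaehlerDifferential.span_range_derivation, eq_comm, Submodule.span_eq_bot]
      rintro _ ⟨x, rfl⟩
      exact hall x
    exact (Submodule.subsingleton_iff E).1 hs
  have := (Algebra.FormallyUnramified.iff_isSeparable k E).1 hU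
  have h5 : IsAlgebraic k yE := Algebra.IsAlgebraic.isAlgebraic yE
  exact h5.algebraMap (A := L)

lemma aux_deriv_aeval {k L M : Type} {n : ℕ} [Field k] [Field L] [Algebra k L] [AddCommGroup M]
    [Module L M] [Module k M]
    (D : Derivation k L M) (x : Fin n → L) (g : MvPolynomial (Fin n) k) :
    D (MvPolynomial.aeval x g) =
      ∑ i, (MvPolynomial.aeval x (MvPolynomial.pderiv i g)) • D (x i) := by
  induction g using MvPolynomial.induction_on with
  | C a => simp
  | add p q hp hq => simp [hp, hq, add_smul, Finset.sum_add_distrib]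
  | mul_X p j hp =>
    simp [hp, MvPolynomial.pderiv_X, Pi.single_apply, add_smul, Finset.sum_add_distrib,
      Finset.smul_sum, smul_smul, mul_comm, apply_ite (MvPolynomial.aeval x), ite_smul, add_comm]

open scoped IntermediateField.algebraAdjoinAdjoin in
lemma aux_rel_ess {L : Type} [Field L] [Algebra ℝ L] [Algebra.EssFiniteType ℝ L] {n : ℕ}
    (g : MvPolynomial (Fin n) ℝ) (x : Fin n → L) (l : L)
    (h : ∀ i, MvPolynomial.aeval x (MvPolynomial.pderiv i g) = l * x i) :
    ∃ P : Polynomial (Polynomial ℝ), P ≠ 0 ∧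
      P.eval₂ (Polynomial.aeval (∑ i, x i ^ 2 : L)).toRingHom (MvPolynomial.aeval x g) = 0 := by
  set r : L := ∑ i, x i ^ 2 with hr
  set y : L := MvPolynomial.aeval x g with hy
  let k := IntermediateField.adjoin ℝ ({r} : Set L)
  have : CharZero k := charZero_of_injective_algebraMap (algebraMap ℝ k).injective
  have h1 : Algebra.EssFiniteType k L := Algebra.EssFiniteType.of_comp ℝ k L
  let D := KaehlerDifferential.D k L
  have hDr : D r = 0 :=
    D.map_algebraMap (⟨r, IntermediateField.mem_adjoin_simple_self ℝ r⟩ : k)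
  have hDy : D y = 0 := by
    have e1 := aux_deriv_aeval (D.restrictScalars ℝ) x g
    have e2 : (D.restrictScalars ℝ) (MvPolynomial.aeval x g) = D y := rfl
    rw [e2] at e1
    rw [e1]
    have e3 : D r = ∑ i, (2 * x i) • D (x i) := by
      rw [hr, map_sum]
      refine Finset.sum_congr rfl fun i _ => ?_
      rw [Derivation.leibniz_pow]
      simp [two_mul, add_smul, two_smul]
    have e4 : (l / 2) • D r = 0 := by rw [hDr, smul_zero]
    rw [e3, Finset.smul_sum] at e4
    have : CharZero L := charZero_of_injective_algebraMap (algebraMap ℝ L).injective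
    rw [← e4]
    refine Finset.sum_congr rfl fun i _ => ?_
    rw [h, smul_smul]
    congr 1
    field_simp
  have halg : IsAlgebraic k y := aux_alg_of_D_eq_zero y hDy
  have halg2 : IsAlgebraic (Algebra.adjoin ℝ ({r} : Set L)) y :=
    (IsFractionRing.isAlgebraic_iff (Algebra.adjoin ℝ ({r} : Set L)) k L).2 halg
  obtain ⟨p, hp0, hp⟩ := halg2
  have hsurj : Function.Surjective
      ((Polynomial.aeval (⟨r, Algebra.self_mem_adjoin_singleton ℝ r⟩ :
        Algebra.adjoin ℝ ({r} : Set L)) : Polynomial ℝ →ₐ[ℝ] _).toRingHom) := by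
    rintro ⟨z, hz⟩
    rw [Algebra.adjoin_singleton_eq_range_aeval] at hz
    obtain ⟨q, rfl⟩ := hz
    refine ⟨q, Subtype.ext ?_⟩
    have := Polynomial.aeval_algebraMap_apply L
      (⟨r, Algebra.self_mem_adjoin_singleton ℝ r⟩ : Algebra.adjoin ℝ ({r} : Set L)) q
    exact this.symm
  obtain ⟨P, hP⟩ := Polynomial.map_surjective _ hsurj p
  refine ⟨P, ?_, ?_⟩
  · rintro rfl
    exact hp0 (by rw [← hP, Polynomial.map_zero])
  · rw [← hP, Polynomial.aeval_def, Polynomial.eval₂_map] at hp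
    rw [← hp]
    congr 1
    ext q
    · simp
    · simp

lemma aux_rel {H : Type} [Field H] [Algebra ℝ H] {n : ℕ}
    (g : MvPolynomial (Fin n) ℝ) (x : Fin n → H) (l : H)
    (h : ∀ i, MvPolynomial.aeval x (MvPolynomial.pderiv i g) = l * x i) :
    ∃ P : Polynomial (Polynomial ℝ), P ≠ 0 ∧
      P.eval₂ (Polynomial.aeval (∑ i, x i ^ 2 : H)).toRingHom (MvPolynomial.aeval x g) = 0 := by
  classical
  let S : Finset H := insert l (Finset.univ.image x)
  let L := IntermediateField.adjoin ℝ (S : Set H)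
  have : Algebra.EssFiniteType ℝ L := by
    rw [IntermediateField.essFiniteType_iff]
    exact ⟨S, rfl⟩
  let x' : Fin n → L := fun i => ⟨x i, IntermediateField.subset_adjoin _ _ (by simp [S])⟩
  let l' : L := ⟨l, IntermediateField.subset_adjoin _ _ (by simp [S])⟩
  have hx' : ∀ q : MvPolynomial (Fin n) ℝ,
      MvPolynomial.aeval x q = algebraMap L H (MvPolynomial.aeval x' q) := fun q => by
    rw [← MvPolynomial.aeval_algebraMap_apply]
    rfl
  obtain ⟨P, hP, hP2⟩ := aux_rel_ess g x' l' (fun i => by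
    apply (algebraMap L H).injective
    rw [← hx', h]
    rfl)
  refine ⟨P, hP, ?_⟩
  have := congrArg (algebraMap L H) hP2
  rw [map_zero, Polynomial.hom_eval₂, ← hx'] at this
  rw [← this]
  congr 1
  ext q
  · simp [← IsScalarTower.algebraMap_apply]
  · simp [x']
open Filter Topology

lemma aux_fderiv {n : ℕ} (g : MvPolynomial (Fin n) ℝ) (x : Fin n → ℝ) :
    HasStrictFDerivAt (fun z : Fin n → ℝ => MvPolynomial.eval z g)
      (∑ i, (MvPolynomial.eval x (MvPolynomial.pderiv i g)) •
        (ContinuousLinearMap.proj i : (Fin n → ℝ) →L[ℝ] ℝ)) x := by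
  induction g using MvPolynomial.induction_on with
  | C a => simpa using hasStrictFDerivAt_const a x
  | add p q hp hq =>
    have e : (fun z : Fin n → ℝ => MvPolynomial.eval z (p + q)) =
      (fun z : Fin n → ℝ => MvPolynomial.eval z p) + fun z => MvPolynomial.eval z q := by
      ext; simp
    rw [e]
    refine (hp.add hq).congr_fderiv ?_
    simp [add_smul, Finset.sum_add_distrib]
  | mul_X p j hp =>
    have h1 : HasStrictFDerivAt (fun z : Fin n → ℝ => z j)
        (ContinuousLinearMap.proj j : (Fin n → ℝ) →L[ℝ] ℝ) x :=
      (ContinuousLinearMap.proj j : (Fin n → ℝ) →L[ℝ] ℝ).hasStrictFDerivAt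
    have h2 := hp.mul h1
    have e : (fun z : Fin n → ℝ => MvPolynomial.eval z (p * MvPolynomial.X j)) =
      (fun z : Fin n → ℝ => MvPolynomial.eval z p) * fun z => z j := by ext; simp
    rw [e]
    refine h2.congr_fderiv ?_
    ext v
    simp [MvPolynomial.pderiv_X, Pi.single_apply, Finset.sum_add_distrib,
      Finset.mul_sum, mul_comm, mul_assoc, mul_left_comm, add_mul, mul_add,
      apply_ite (MvPolynomial.eval x), add_comm]

lemma aux_lagrange {n : ℕ} (g : MvPolynomial (Fin n) ℝ) (x : Fin n → ℝ)
    (hx : 0 < ∑ i, x i ^ 2)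
    (hmin : ∀ z : Fin n → ℝ, ∑ i, z i ^ 2 = ∑ i, x i ^ 2 →
      MvPolynomial.eval x g ≤ MvPolynomial.eval z g) :
    ∃ l : ℝ, ∀ i, MvPolynomial.eval x (MvPolynomial.pderiv i g) = l * x i := by
  let q : MvPolynomial (Fin n) ℝ := ∑ i, MvPolynomial.X i ^ 2
  have hq : ∀ z : Fin n → ℝ, MvPolynomial.eval z q = ∑ i, z i ^ 2 := fun z => by simp [q]
  have hext : IsLocalExtrOn (fun z : Fin n → ℝ => MvPolynomial.eval z g)
      {z | MvPolynomial.eval z q = MvPolynomial.eval x q} x := by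
    left
    refine IsMinOn.localize (fun z hz => ?_)
    simp only [Set.mem_ofPred_eq, hq] at hz
    exact hmin z hz
  obtain ⟨a, b, hab, h⟩ := hext.exists_multipliers_of_hasStrictFDerivAt_1d
    (aux_fderiv q x) (aux_fderiv g x)
  have hi : ∀ i, a * (2 * x i) + b * MvPolynomial.eval x (MvPolynomial.pderiv i g) = 0 := by
    intro i
    have := DFunLike.congr_fun h (Pi.single i 1)
    have hq' : MvPolynomial.eval x (MvPolynomial.pderiv i q) = 2 * x i := by
      simp [q, MvPolynomial.pderiv_X, Pi.single_apply, Derivation.leibniz_pow]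
    simpa [Pi.single_apply, hq'] using this
  have hb : b ≠ 0 := by
    rintro rfl
    have ha : a ≠ 0 := by rintro rfl; exact hab rfl
    have : ∀ i, x i = 0 := fun i => by simpa [ha] using hi i
    simp [this] at hx
  refine ⟨-(2 * a / b), fun i => ?_⟩
  have := hi i
  field_simp
  linarith

lemma aux_poly_bound (p : Polynomial ℝ) : ∃ (C : ℝ) (M : ℕ), 0 ≤ C ∧
    ∀ r : ℝ, 0 ≤ r → |p.eval r| ≤ C * (1 + r) ^ M := by
  induction p using Polynomial.induction_on' with
  | add p q hp hq =>
    obtain ⟨C, M, hC, h⟩ := hp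
    obtain ⟨C', M', hC', h'⟩ := hq
    refine ⟨C + C', M + M', by positivity, fun r hr => ?_⟩
    have h1 : (1 + r) ^ M ≤ (1 + r) ^ (M + M') := pow_le_pow_right₀ (by linarith) (by omega)
    have h2 : (1 + r) ^ M' ≤ (1 + r) ^ (M + M') := pow_le_pow_right₀ (by linarith) (by omega)
    rw [Polynomial.eval_add]
    refine (abs_add_le _ _).trans ?_
    nlinarith [h r hr, h' r hr, mul_le_mul_of_nonneg_left h1 hC, mul_le_mul_of_nonneg_left h2 hC']
  | monomial k a =>
    refine ⟨|a|, k, abs_nonneg _, fun r hr => ?_⟩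
    rw [Polynomial.eval_monomial, abs_mul, abs_pow, abs_of_nonneg hr]
    gcongr
    linarith

/-- bivariate version -/
lemma aux_bipoly_bound (P : Polynomial (Polynomial ℝ)) : ∃ (C : ℝ) (M : ℕ), 0 ≤ C ∧
    ∀ r y : ℝ, 0 ≤ r → |y| ≤ 1 → |P.eval₂ (Polynomial.evalRingHom r) y| ≤ C * (1 + r) ^ M := by
  induction P using Polynomial.induction_on' with
  | add p q hp hq =>
    obtain ⟨C, M, hC, h⟩ := hp
    obtain ⟨C', M', hC', h'⟩ := hq
    refine ⟨C + C', M + M', by positivity, fun r y hr hy => ?_⟩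
    have h1 : (1 + r) ^ M ≤ (1 + r) ^ (M + M') := pow_le_pow_right₀ (by linarith) (by omega)
    have h2 : (1 + r) ^ M' ≤ (1 + r) ^ (M + M') := pow_le_pow_right₀ (by linarith) (by omega)
    rw [Polynomial.eval₂_add]
    refine (abs_add_le _ _).trans ?_
    nlinarith [h r y hr hy, h' r y hr hy, mul_le_mul_of_nonneg_left h1 hC,
      mul_le_mul_of_nonneg_left h2 hC']
  | monomial k a =>
    obtain ⟨C, M, hC, h⟩ := aux_poly_bound a
    refine ⟨C, M, hC, fun r y hr hy => ?_⟩
    rw [Polynomial.eval₂_monomial, abs_mul, abs_pow]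
    have : |y| ^ k ≤ 1 := pow_le_one₀ (abs_nonneg _) hy
    calc _ ≤ |(Polynomial.evalRingHom r) a| * 1 := by gcongr
      _ ≤ _ := by simpa using h r hr

lemma aux_contra (P : Polynomial (Polynomial ℝ)) (hP : P ≠ 0) : ∃ N : ℕ, ∃ R : ℝ,
    ∀ m : ℕ, ∀ r y : ℝ, N ≤ m → R ≤ r → 0 < y → y * (1 + r) ^ m * (m + 1) < 1 →
      P.eval₂ (Polynomial.evalRingHom r) y ≠ 0 := by
  -- factor
  have hfac : ∃ (k : ℕ) (Q : Polynomial (Polynomial ℝ)), P = Polynomial.X ^ k * Q ∧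
      Q.coeff 0 ≠ 0 := by
    obtain ⟨Q, hQ, h⟩ := Polynomial.exists_eq_pow_rootMultiplicity_mul_and_not_dvd P hP 0
    rw [Polynomial.C_0, sub_zero] at hQ h
    exact ⟨_, Q, hQ, fun h0 => h (Polynomial.X_dvd_iff.2 h0)⟩
  obtain ⟨k, Q, rfl, hQ⟩ := hfac
  obtain ⟨C, M, hC, hb⟩ := aux_bipoly_bound Q.divX
  have hlow : ∃ d > 0, ∃ R : ℝ, ∀ r ≥ R, d ≤ |(Q.coeff 0).eval r| := by
    by_cases hd : 0 < (Q.coeff 0).degree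
    · obtain ⟨R, hR⟩ := ((Q.coeff 0).abs_tendsto_atTop hd).eventually_ge_atTop 1 |>.exists_forall_of_atTop
      exact ⟨1, one_pos, R, hR⟩
    · have h0 := Polynomial.eq_C_of_degree_le_zero (not_lt.1 hd)
      refine ⟨|(Q.coeff 0).coeff 0|, ?_, 0, fun r _ => ?_⟩
      · rw [gt_iff_lt, abs_pos]
        intro h; rw [h] at h0; exact hQ (by simpa using h0)
      · rw [h0]; simp
  obtain ⟨d, hd, R, hR⟩ := hlow
  obtain ⟨N0, hN0⟩ := exists_nat_gt (C / d)
  refine ⟨max M N0, max R 0, fun m r y hm hr hy hlt heq => ?_⟩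
  have hr0 : 0 ≤ r := le_trans (le_max_right _ _) hr
  rw [Polynomial.eval₂_mul, Polynomial.eval₂_X_pow] at heq
  have hQ0 : Q.eval₂ (Polynomial.evalRingHom r) y = 0 :=
    (mul_eq_zero.1 heq).resolve_left (pow_ne_zero _ hy.ne')
  rw [← Polynomial.divX_mul_X_add Q, Polynomial.eval₂_add, Polynomial.eval₂_mul,
    Polynomial.eval₂_X, Polynomial.eval₂_C] at hQ0
  have h1 : (1:ℝ) ≤ (1 + r) ^ m := one_le_pow₀ (by linarith)
  have hm1 : (1 + r) ^ M ≤ (1 + r) ^ m :=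
    pow_le_pow_right₀ (by linarith) ((le_max_left _ _).trans hm)
  have hmn : (N0 : ℝ) ≤ m := by exact_mod_cast (le_max_right _ _).trans hm
  have hy1 : |y| ≤ 1 := by
    rw [abs_of_pos hy]
    by_contra hcon
    push Not at hcon
    have : 1 ≤ y * (1 + r) ^ m * (m + 1) := by
      have : (1:ℝ) ≤ m + 1 := by linarith [Nat.cast_nonneg (α := ℝ) m]
      have := one_le_mul_of_one_le_of_one_le (one_le_mul_of_one_le_of_one_le hcon.le h1) this
      exact this
    linarith
  have hb' := hb r y hr0 hy1
  have hR' := hR r (le_trans (le_max_left _ _) hr)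
  have h3 : (Q.coeff 0).eval r = - (Q.divX.eval₂ (Polynomial.evalRingHom r) y * y) := by
    have : (Polynomial.evalRingHom r) (Q.coeff 0) = (Q.coeff 0).eval r := rfl
    linarith
  rw [h3, abs_neg, abs_mul, abs_of_pos hy] at hR'
  have h4 : d ≤ C * (y * (1 + r) ^ m) := by
    calc d ≤ _ := hR'
      _ ≤ (C * (1 + r) ^ M) * y := by gcongr
      _ ≤ (C * (1 + r) ^ m) * y := by gcongr
      _ = _ := by ring
  have hm0 : (0:ℝ) < m + 1 := by positivity
  have h5 : d * (m + 1) ≤ C := by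
    calc d * (m+1) ≤ (C * (y * (1 + r) ^ m)) * (m+1) := by gcongr
      _ = C * (y * (1 + r) ^ m * (m + 1)) := by ring
      _ ≤ C * 1 := by gcongr
      _ = C := mul_one C
  rw [div_lt_iff₀ hd] at hN0
  nlinarith

lemma aux_exists_min {n : ℕ} (g : MvPolynomial (Fin n) ℝ) (y : Fin n → ℝ) :
    ∃ x : Fin n → ℝ, ∑ i, x i ^ 2 = ∑ i, y i ^ 2 ∧
      ∀ z : Fin n → ℝ, ∑ i, z i ^ 2 = ∑ i, y i ^ 2 →
        MvPolynomial.eval x g ≤ MvPolynomial.eval z g := by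
  have hc : IsCompact {z : Fin n → ℝ | ∑ i, z i ^ 2 = ∑ i, y i ^ 2} := by
    refine Metric.isCompact_of_isClosed_isBounded
      (isClosed_eq (by fun_prop) continuous_const) ?_
    refine (Metric.isBounded_closedBall (x := (0 : Fin n → ℝ))
      (r := √(∑ i, y i ^ 2))).subset fun z hz => ?_
    rw [mem_closedBall_zero_iff, pi_norm_le_iff_of_nonneg (Real.sqrt_nonneg _)]
    intro i
    rw [Real.norm_eq_abs]
    apply Real.abs_le_sqrt
    rw [← show ∑ i, z i ^ 2 = ∑ i, y i ^ 2 from hz]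
    exact Finset.single_le_sum (f := fun i => z i ^ 2) (fun i _ => sq_nonneg _) (Finset.mem_univ i)
  obtain ⟨x, hx, hmin⟩ := hc.exists_isMinOn ⟨y, rfl⟩
    (f := fun z => MvPolynomial.eval z g) (MvPolynomial.continuous_eval g).continuousOn
  exact ⟨x, hx, fun z hz => hmin hz⟩

lemma aux_lower_ball {n : ℕ} (g : MvPolynomial (Fin n) ℝ)
    (hg : ∀ x, 0 < MvPolynomial.eval x g) (R : ℝ) :
    ∃ d > 0, ∀ z : Fin n → ℝ, ∑ i, z i ^ 2 ≤ R → d ≤ MvPolynomial.eval z g := by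
  have hc : IsCompact {z : Fin n → ℝ | ∑ i, z i ^ 2 ≤ R} := by
    refine Metric.isCompact_of_isClosed_isBounded
      (isClosed_le (by fun_prop) continuous_const) ?_
    refine (Metric.isBounded_closedBall (x := (0 : Fin n → ℝ))
      (r := √R)).subset fun z hz => ?_
    rw [mem_closedBall_zero_iff, pi_norm_le_iff_of_nonneg (Real.sqrt_nonneg _)]
    intro i
    rw [Real.norm_eq_abs]
    apply Real.abs_le_sqrt
    refine le_trans ?_ (show ∑ i, z i ^ 2 ≤ R from hz)
    exact Finset.single_le_sum (f := fun i => z i ^ 2) (fun i _ => sq_nonneg _) (Finset.mem_univ i)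
  by_cases hne : {z : Fin n → ℝ | ∑ i, z i ^ 2 ≤ R}.Nonempty
  · obtain ⟨x, hx, hmin⟩ := hc.exists_isMinOn hne
      (f := fun z => MvPolynomial.eval z g) (MvPolynomial.continuous_eval g).continuousOn
    exact ⟨_, hg x, fun z hz => hmin hz⟩
  · exact ⟨1, one_pos, fun z hz => (hne ⟨z, hz⟩).elim⟩

lemma aux_main {n : ℕ} (g : MvPolynomial (Fin n) ℝ) (hg : ∀ x, 0 < MvPolynomial.eval x g) :
    ∃ N : ℕ, ∀ x : Fin n → ℝ,
      1 ≤ MvPolynomial.eval x g * (1 + ∑ i, x i ^ 2) ^ N * (N + 1) := by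
  by_contra hcon
  push Not at hcon
  -- sequence of minimizers
  have hX : ∀ m : ℕ, ∃ x : Fin n → ℝ,
      MvPolynomial.eval x g * (1 + ∑ i, x i ^ 2) ^ m * (m + 1) < 1 ∧
      ∀ z : Fin n → ℝ, ∑ i, z i ^ 2 = ∑ i, x i ^ 2 →
        MvPolynomial.eval x g ≤ MvPolynomial.eval z g := by
    intro m
    obtain ⟨y, hy⟩ := hcon m
    obtain ⟨x, hx, hmin⟩ := aux_exists_min g y
    refine ⟨x, lt_of_le_of_lt ?_ hy, by rw [hx]; exact hmin⟩
    rw [hx]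
    have h0 : 0 ≤ ∑ i, y i ^ 2 := Finset.sum_nonneg fun i _ => sq_nonneg _
    gcongr
    exact hmin y rfl
  choose X hX1 hX2 using hX
  have hr0 : ∀ m, 0 ≤ ∑ i, X m i ^ 2 := fun m => Finset.sum_nonneg fun i _ => sq_nonneg _
  have hinf : ∀ R : ℝ, ∃ M : ℕ, ∀ m ≥ M, R ≤ ∑ i, X m i ^ 2 := by
    intro R
    obtain ⟨d, hd, h⟩ := aux_lower_ball g hg R
    obtain ⟨M, hM⟩ := exists_nat_gt (1 / d)
    refine ⟨M, fun m hm => ?_⟩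
    by_contra hlt
    push Not at hlt
    have h1 := h (X m) hlt.le
    have h2 : (1:ℝ) ≤ (1 + ∑ i, X m i ^ 2) ^ m := one_le_pow₀ (by linarith [hr0 m])
    have hmM : (M : ℝ) ≤ m := by exact_mod_cast hm
    have h3 : d * 1 * (m + 1) ≤ MvPolynomial.eval (X m) g * (1 + ∑ i, X m i ^ 2) ^ m * (m + 1) := by
      have := (hg (X m)).le
      gcongr
    rw [div_lt_iff₀ hd] at hM
    nlinarith [hX1 m]
  have hlam : ∀ m : ℕ, ∃ l : ℝ, 0 < ∑ i, X m i ^ 2 → 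
      ∀ i, MvPolynomial.eval (X m) (MvPolynomial.pderiv i g) = l * X m i := by
    intro m
    by_cases h : 0 < ∑ i, X m i ^ 2
    · obtain ⟨l, hl⟩ := aux_lagrange g (X m) h (hX2 m)
      exact ⟨l, fun _ => hl⟩
    · exact ⟨0, fun h' => (h h').elim⟩
  choose lam hlam using hlam
  -- hyperreals
  let π : (ℕ → ℝ) →+* ℝ* := Filter.Germ.coeRingHom (hyperfilter ℕ : Filter ℕ)
  have hπ : ∀ u v : ℕ → ℝ, π u = π v ↔ ∀ᶠ m in (hyperfilter ℕ : Filter ℕ), u m = v m :=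
    fun u v => Filter.Germ.coe_eq
  let alg : Algebra ℝ ℝ* := (π.comp (Pi.constRingHom ℕ ℝ)).toAlgebra
  let πa : (ℕ → ℝ) →ₐ[ℝ] ℝ* := { π with commutes' := fun _ => rfl }
  let Xs : Fin n → (ℕ → ℝ) := fun i m => X m i
  have haev : ∀ q : MvPolynomial (Fin n) ℝ, MvPolynomial.aeval (fun i => πa (Xs i)) q =
      πa (fun m => MvPolynomial.eval (X m) q) := by
    intro q
    have h1 : MvPolynomial.aeval (fun i => πa (Xs i)) q = πa (MvPolynomial.aeval Xs q) := by
      rw [← MvPolynomial.comp_aeval_apply]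
    rw [h1]
    congr 1
    ext m
    have h2 : Pi.evalAlgHom ℝ (fun _ : ℕ => ℝ) m (MvPolynomial.aeval Xs q) =
        MvPolynomial.aeval (X m) q := by
      rw [MvPolynomial.comp_aeval_apply]
      rfl
    simpa [MvPolynomial.coe_aeval_eq_eval] using h2
  obtain ⟨M1, hM1⟩ := hinf 1
  have hev : ∀ M : ℕ, ∀ᶠ m in (hyperfilter ℕ : Filter ℕ), M ≤ m := fun M =>
    (Nat.hyperfilter_le_atTop) (eventually_ge_atTop M)
  obtain ⟨P, hP0, hP⟩ := aux_rel g (fun i => πa (Xs i)) (πa lam) (fun i => by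
    rw [haev, ← map_mul]
    refine (hπ _ _).2 ?_
    filter_upwards [hev M1] with m hm
    exact hlam m (by linarith [hM1 m hm]) i)
  let rs : ℕ → ℝ := fun m => ∑ i, X m i ^ 2
  have hrs : (∑ i, πa (Xs i) ^ 2 : ℝ*) = πa rs := by
    have : rs = ∑ i, Xs i ^ 2 := by ext m; simp [rs, Xs]
    rw [this, map_sum]
    simp only [map_pow]
  rw [hrs, haev] at hP
  have hPm : πa (fun m => P.eval₂ (Polynomial.evalRingHom (rs m)) (MvPolynomial.eval (X m) g)) =
      πa 0 := by
    rw [map_zero, ← hP]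
    have h1 : ((Polynomial.aeval (πa rs) : Polynomial ℝ →ₐ[ℝ] ℝ*)).toRingHom =
        πa.toRingHom.comp (Polynomial.aeval rs : Polynomial ℝ →ₐ[ℝ] (ℕ → ℝ)).toRingHom := by
      ext a
      · simp
      · simp
    rw [h1]
    have h2 := Polynomial.hom_eval₂ P
      (Polynomial.aeval rs : Polynomial ℝ →ₐ[ℝ] (ℕ → ℝ)).toRingHom πa.toRingHom
      (fun m => MvPolynomial.eval (X m) g)
    refine Eq.trans ?_ h2
    change πa _ = πa _
    congr 1
    ext m
    have h3 := Polynomial.hom_eval₂ P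
      (Polynomial.aeval rs : Polynomial ℝ →ₐ[ℝ] (ℕ → ℝ)).toRingHom
      (Pi.evalRingHom (fun _ : ℕ => ℝ) m)
      (fun m => MvPolynomial.eval (X m) g)
    refine Eq.trans ?_ h3.symm
    congr 1
    ext a
    · simp
    · simp
  have hPe := (hπ _ _).1 hPm
  obtain ⟨N, R, hNR⟩ := aux_contra P hP0
  obtain ⟨M2, hM2⟩ := hinf R
  obtain ⟨m, h1, h2, h3⟩ := (hPe.and ((hev N).and (hev M2))).exists
  exact hNR m (rs m) _ h2 (hM2 m h3) (hg (X m)) (hX1 m) h1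

/-- Correction for polynomial rings. -/
lemma aux_poly {n : ℕ} (K : Ideal (MvPolynomial (Fin n) ℝ)) (a : MvPolynomial (Fin n) ℝ)
    (ha : ∀ x : Fin n → ℝ, (∀ p ∈ K, MvPolynomial.eval x p = 0) → 0 < MvPolynomial.eval x a) :
    ∃ c ∈ K, ∀ x : Fin n → ℝ, 0 < MvPolynomial.eval x (a + c) := by
  obtain ⟨T, hT⟩ := (IsNoetherian.noetherian K : K.FG)
  let s : MvPolynomial (Fin n) ℝ := ∑ p ∈ T, p ^ 2
  have hsK : s ∈ K := Ideal.sum_mem _ fun p hp =>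
    Ideal.pow_mem_of_mem _ (hT ▸ Submodule.subset_span hp) 2 two_pos
  have hs : ∀ x, MvPolynomial.eval x s = ∑ p ∈ T, MvPolynomial.eval x p ^ 2 := fun x => by
    simp [s]
  have hs0 : ∀ x, 0 ≤ MvPolynomial.eval x s := fun x => by
    rw [hs]; exact Finset.sum_nonneg fun _ _ => sq_nonneg _
  have hsa : ∀ x, MvPolynomial.eval x s = 0 → 0 < MvPolynomial.eval x a := by
    intro x hx
    apply ha
    rw [hs, Finset.sum_eq_zero_iff_of_nonneg fun _ _ => sq_nonneg _] at hx
    have hle : K ≤ RingHom.ker (MvPolynomial.eval x) := by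
      rw [← hT]
      refine Submodule.span_le.2 fun p hp => ?_
      simpa using hx p hp
    exact fun p hp => hle hp
  let ι : MvPolynomial (Fin n) ℝ →ₐ[ℝ] MvPolynomial (Fin (n + 1)) ℝ :=
    MvPolynomial.rename Fin.succ
  have hι : ∀ (p) (z : Fin (n + 1) → ℝ),
      MvPolynomial.eval z (ι p) = MvPolynomial.eval (fun i => z i.succ) p := fun p z => by
    simp [ι, MvPolynomial.eval_rename, Function.comp_def]
  let g : MvPolynomial (Fin (n + 1)) ℝ := ι s ^ 2 + (ι a + MvPolynomial.X 0 ^ 2) ^ 2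
  have hgv : ∀ z : Fin (n + 1) → ℝ, MvPolynomial.eval z g =
      MvPolynomial.eval (fun i => z i.succ) s ^ 2 +
        (MvPolynomial.eval (fun i => z i.succ) a + z 0 ^ 2) ^ 2 := fun z => by
    simp [g, hι]
  obtain ⟨N, hN⟩ := aux_main g (fun z => by
    rw [hgv]
    by_cases h : MvPolynomial.eval (fun i => z i.succ) s = 0
    · have := hsa _ h
      positivity
    · positivity)
  let w : MvPolynomial (Fin n) ℝ := 2 + ∑ i, MvPolynomial.X i ^ 2 + a ^ 2
  let h : MvPolynomial (Fin n) ℝ := s * w ^ N * ((N : MvPolynomial (Fin n) ℝ) + 1) * (1 + a ^ 2)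
  refine ⟨h * s, Ideal.mul_mem_left _ _ hsK, fun x => ?_⟩
  have hw : MvPolynomial.eval x w = 2 + ∑ i, x i ^ 2 + MvPolynomial.eval x a ^ 2 := by
    simp [w]
  have hh : MvPolynomial.eval x (a + h * s) = MvPolynomial.eval x a +
      (MvPolynomial.eval x s ^ 2 * MvPolynomial.eval x w ^ N * (N + 1)) *
        (1 + MvPolynomial.eval x a ^ 2) := by
    simp [h]
    ring
  rw [hh]
  set α := MvPolynomial.eval x a
  have hr0 : 0 ≤ ∑ i, x i ^ 2 := Finset.sum_nonneg fun i _ => sq_nonneg _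
  have hw0 : 0 ≤ MvPolynomial.eval x w := by rw [hw]; positivity
  by_cases hα : 0 < α
  · have := hs0 x
    positivity
  · push Not at hα
    have h1 := hN (Fin.cons (√(-α)) x)
    rw [hgv] at h1
    simp only [Fin.cons_succ, Fin.cons_zero, Fin.sum_univ_succ] at h1
    rw [Real.sq_sqrt (by linarith)] at h1
    have h2 : (1 + (-α + ∑ i, x i ^ 2)) ^ N ≤ MvPolynomial.eval x w ^ N := by
      apply pow_le_pow_left₀ (by linarith)
      rw [hw]
      nlinarith [sq_nonneg (α + 1), sq_nonneg α]
    have h3 : 1 ≤ MvPolynomial.eval x s ^ 2 * MvPolynomial.eval x w ^ N * (N + 1) := by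
      refine h1.trans ?_
      have : MvPolynomial.eval x a + -α = 0 := by simp [α]
      rw [this]
      simp only [ne_eq, OfNat.ofNat_ne_zero, not_false_eq_true, zero_pow, add_zero]
      gcongr
    nlinarith [sq_nonneg (α + 1), sq_nonneg α, mul_le_mul_of_nonneg_right h3 (by positivity : 0 ≤ 1 + α ^ 2)]

lemma aux_affine (B : Type*) [CommRing B] [Algebra ℝ B] [Algebra.FiniteType ℝ B]
    (K : Ideal B) (a₁ : B)
    (ha₁ : ∀ φ : B →ₐ[ℝ] ℝ, (∀ x ∈ K, φ x = 0) → 0 < φ a₁) :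
    ∃ c ∈ K, ∀ φ : B →ₐ[ℝ] ℝ, 0 < φ (a₁ + c) := by
  obtain ⟨n, p, hp⟩ := Algebra.FiniteType.iff_quotient_mvPolynomial''.1
    (inferInstance : Algebra.FiniteType ℝ B)
  obtain ⟨a, rfl⟩ := hp a₁
  obtain ⟨c, hc, hpos⟩ := aux_poly (K.comap p) a (fun x hx => by
    let ψ : MvPolynomial (Fin n) ℝ →ₐ[ℝ] ℝ := MvPolynomial.aeval x
    have hker : RingHom.ker p ≤ RingHom.ker ψ := fun q hq => by
      have : q ∈ K.comap p := by
        rw [Ideal.mem_comap, (RingHom.mem_ker).1 hq]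
        exact K.zero_mem
      have := hx q this
      rw [RingHom.mem_ker]
      simpa [ψ, MvPolynomial.coe_aeval_eq_eval] using this
    let φ : B →ₐ[ℝ] ℝ := AlgHom.liftOfSurjective p hp ψ hker
    have hφ : ∀ q, φ (p q) = MvPolynomial.eval x q := fun q => by
      have : φ (p q) = ψ q := AlgHom.liftOfSurjective_apply ..
      rw [this]
      simp [ψ, MvPolynomial.coe_aeval_eq_eval]
    rw [← hφ]
    refine ha₁ φ fun b hb => ?_
    obtain ⟨q, rfl⟩ := hp b
    rw [hφ]
    exact hx q hb)
  refine ⟨p c, hc, fun φ => ?_⟩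
  rw [← map_add]
  have h1 := hpos (fun i => φ (p (MvPolynomial.X i)))
  have h2 : (φ.comp p) = MvPolynomial.aeval (fun i => φ (p (MvPolynomial.X i))) := by
    ext i; simp
  have h3 := DFunLike.congr_fun h2 (a + c)
  rw [AlgHom.comp_apply] at h3
  rw [h3]
  simpa [MvPolynomial.coe_aeval_eq_eval] using h1

/-- Let `B` be an affine algebra over `ℝ` and `X = Spec B` (real points of `X` being
identified with the `ℝ`-algebra homomorphisms `B → ℝ`).  Let `f ∈ B` with `f > 0` on `X(ℝ)`,
`K ⊆ B` an ideal, and `a₁ ∈ B` with `a₁ > 0` on `Z_r(K)`.  Then there is `c ∈ K` with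
`a₁ + c > 0` on `X(ℝ)`; moreover for any ideal `J` with `f^q - a₁ ∈ J` for some `q`, one can
choose `c ∈ KJ`. -/
theorem positive_everywhere_correction
    (B : Type*) [CommRing B] [Algebra ℝ B] [Algebra.FiniteType ℝ B]
    (f : B) (hf : ∀ φ : B →ₐ[ℝ] ℝ, 0 < φ f)
    (K : Ideal B) (a₁ : B)
    (ha₁ : ∀ φ : B →ₐ[ℝ] ℝ, (∀ x ∈ K, φ x = 0) → 0 < φ a₁) :
    (∃ c ∈ K, ∀ φ : B →ₐ[ℝ] ℝ, 0 < φ (a₁ + c)) ∧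
    (∀ J : Ideal B, (∃ q : ℕ, 0 < q ∧ f ^ q - a₁ ∈ J) →
      ∃ c ∈ K * J, ∀ φ : B →ₐ[ℝ] ℝ, 0 < φ (a₁ + c)) := by
  refine ⟨aux_affine B K a₁ ha₁, fun J ⟨q, _, hq⟩ => aux_affine B (K * J) a₁ fun φ hφ => ?_⟩
  by_cases hK : ∀ x ∈ K, φ x = 0
  · exact ha₁ φ hK
  · push Not at hK
    obtain ⟨x, hx, hx0⟩ := hK
    have h1 := hφ _ (Ideal.mul_mem_mul hx hq)
    rw [map_mul] at h1
    have h2 := (mul_eq_zero.1 h1).resolve_left hx0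
    rw [map_sub, map_pow, sub_eq_zero] at h2
    rw [← h2]
    exact pow_pos (hf φ) q
end
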